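/- arXiv:1810.02288 — 2 statements merged into one kernel-verified Lean document; each statement's English description precedes it below -/
import Mathlib

section
/- Let n ≥ 2 and K ⊂ ℝⁿ be a convex body (a compact convex set with nonempty interior), and let c = (1/vol(K)) ∫_K x dx be its center of mass. Then vol(K) · vol((K − c)°) ≤ ω_n², where (K − c)° = { y ∈ ℝⁿ : ⟨y, z − c⟩ ≤ 1 for all z ∈ K } is the polar body of K − c and ω_n is the Lebesgue measure of the Euclidean unit ball in ℝⁿ. Equality holds if and only if K is an ellipsoid. -/
open MeasureTheory Real
open scoped RealInnerProductSpace
open Set Filter Topology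
open scoped Pointwise

theorem exists_mass_transport {f g : ℝ → ℝ} (hf : Continuous f) (hg : Continuous g)
    (hf0 : ∀ x, 0 < f x) (hg0 : ∀ x, 0 < g x)
    (hfi : IntegrableOn f (Ioi 0)) (hgi : IntegrableOn g (Ioi 0)) :
    ∃ T : ℝ → ℝ, ∀ s, 0 < s → 0 < T s ∧
      HasDerivAt T (f s * (∫ t in Ioi 0, g t) / ((∫ t in Ioi 0, f t) * g (T s))) s := by
  have strict : ∀ {h : ℝ → ℝ}, Continuous h → (∀ x, 0 < h x) →
      StrictMono (fun s : ℝ => ∫ t in (0 : ℝ)..s, h t) := fun hc hp =>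
    strictMono_of_deriv_pos fun x => by
      rw [(hc.integral_hasStrictDerivAt 0 x).hasDerivAt.deriv]; exact hp x
  have lim : ∀ {h : ℝ → ℝ}, IntegrableOn h (Ioi 0) →
      Tendsto (fun s : ℝ => ∫ t in (0 : ℝ)..s, h t) atTop (𝓝 (∫ t in Ioi 0, h t)) := fun hi =>
    intervalIntegral_tendsto_integral_Ioi 0 hi tendsto_id
  set Φ := fun s : ℝ => ∫ t in (0 : ℝ)..s, f t with hΦ
  set Γ := fun s : ℝ => ∫ t in (0 : ℝ)..s, g t with hΓ
  set F := ∫ t in Ioi 0, f t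
  set G := ∫ t in Ioi 0, g t
  have hΦm : StrictMono Φ := strict hf hf0
  have hΓm : StrictMono Γ := strict hg hg0
  have hΦ0 : Φ 0 = 0 := by simp [hΦ]
  have hΓ0 : Γ 0 = 0 := by simp [hΓ]
  have hlt : ∀ {h : ℝ → ℝ} {A : ℝ}, StrictMono h → Tendsto h atTop (𝓝 A) → ∀ s, h s < A :=
    fun hm hl s => (hm (lt_add_one s)).trans_le (hm.monotone.ge_of_tendsto hl _)
  have hF : 0 < F := by have := hlt hΦm (lim hfi) 0; rwa [hΦ0] at this
  have hG : 0 < G := by have := hlt hΓm (lim hgi) 0; rwa [hΓ0] at this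
  have hΓc : Continuous Γ := continuous_iff_continuousAt.2 fun x =>
    (hg.integral_hasStrictDerivAt 0 x).hasDerivAt.continuousAt
  refine ⟨fun s => Function.invFun Γ (Φ s * (G / F)), fun s hs => ?_⟩
  obtain ⟨t, ht⟩ : Φ s * (G / F) ∈ range Γ := by
    refine mem_range_of_exists_le_of_exists_ge hΓc ⟨0, ?_⟩ ?_
    · rw [hΓ0]
      have := hΦm hs
      rw [hΦ0] at this
      positivity
    · have h1 : Φ s * (G / F) < G := by
        rw [← mul_div_assoc, div_lt_iff₀ hF, mul_comm]
        exact mul_lt_mul_of_pos_left (hlt hΦm (lim hfi) s) hG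
      obtain ⟨N, hN⟩ := ((lim hgi).eventually_const_lt h1).exists
      exact ⟨N, hN.le⟩
  have hinv : Function.invFun Γ (Φ s * (G / F)) = t := by
    rw [← ht, Function.leftInverse_invFun hΓm.injective]
  have htpos : 0 < t := by
    rw [← hΓm.lt_iff_lt, ht, hΓ0]
    have := hΦm hs
    rw [hΦ0] at this
    positivity
  have hd := hg.integral_hasStrictDerivAt 0 t
  have hI : HasDerivAt (Function.invFun Γ) (g t)⁻¹ (Γ t) := by
    refine (hd.to_localInverse (hg0 t).ne').hasDerivAt.congr_of_eventuallyEq ?_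
    have h2 := (hd.hasStrictFDerivAt_equiv (hg0 t).ne').eventually_right_inverse
    filter_upwards [h2] with y hy
    apply hΓm.injective
    exact (Function.invFun_eq (f := Γ) ⟨_, hy⟩).trans hy.symm
  have hΦd : HasDerivAt (fun s => Φ s * (G / F)) (f s * (G / F)) s :=
    ((hf.integral_hasStrictDerivAt 0 s).hasDerivAt).mul_const _
  dsimp only
  rw [hinv]
  refine ⟨htpos, ?_⟩
  rw [ht] at hI
  refine (hI.comp s hΦd).congr_deriv ?_
  have := (hg0 t).ne'
  field_simp

theorem integral_mul_integral_Ioi_le {f g : ℝ → ℝ} (hf : Continuous f) (hg : Continuous g)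
    (hf0 : ∀ x, 0 < f x) (hg0 : ∀ x, 0 < g x)
    (hfi : IntegrableOn f (Ioi 0)) (hgi : IntegrableOn g (Ioi 0)) {K : ℝ} (hK : 0 < K)
    (h : ∀ s t, 0 ≤ s → 0 ≤ t → f s * g t ≤ K * exp (-(s * t))) :
    (∫ s in Ioi 0, f s) * (∫ t in Ioi 0, g t) ≤ K * (π / 2) ∧
    ((∫ s in Ioi 0, f s) * (∫ t in Ioi 0, g t) = K * (π / 2) →
      ∃ κ > 0, ∀ t, 0 ≤ t → g t = g 0 * exp (-(κ * t ^ 2 / 2)) ∧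
        f (κ * t) * g t = K * exp (-(κ * t ^ 2))) := by
  obtain ⟨T, hT⟩ := exists_mass_transport hf hg hf0 hg0 hfi hgi
  have posint : ∀ {h : ℝ → ℝ}, (∀ x, 0 < h x) → IntegrableOn h (Ioi 0) →
      0 < ∫ t in Ioi 0, h t := fun hp hi => by
    rw [setIntegral_pos_iff_support_of_nonneg_ae (ae_of_all _ fun x => (hp x).le) hi]
    have : Function.support _ = univ := eq_univ_of_forall fun x => (hp x).ne'
    simp [this]
  have hF := posint hf0 hfi
  have hG := posint hg0 hgi
  set F := ∫ t in Ioi 0, f t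
  set G := ∫ t in Ioi 0, g t
  set T' : ℝ → ℝ := fun s => f s * G / (F * g (T s)) with hT'
  have hT'0 : ∀ s, 0 < T' s := fun s => by
    have := hf0 s; have := hg0 (T s); positivity
  have hTc : ContinuousOn T (Ioi 0) := fun s hs =>
    (hT s hs).2.continuousAt.continuousWithinAt
  have hT'c : ContinuousOn T' (Ioi 0) := by
    refine (hf.continuousOn.mul continuousOn_const).div
      (continuousOn_const.mul (hg.comp_continuousOn hTc)) fun s _ => ?_
    have := hg0 (T s); positivity
  set R : ℝ → ℝ := fun s => √(s * T s) with hR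
  set R' : ℝ → ℝ := fun s => (T s + s * T' s) / (2 * √(s * T s)) with hR'
  have hRd : ∀ s ∈ Ioi (0 : ℝ), HasDerivAt R (R' s) s := fun s hs => by
    have := ((hasDerivAt_id s).mul (hT s hs).2).sqrt
      (mul_pos hs (hT s hs).1).ne'
    simpa using this
  have hR'0 : ∀ s ∈ Ioi (0 : ℝ), 0 < R' s := fun s hs => by
    have := (hT s hs).1; have := hT'0 s; have hs' : 0 < s := hs; positivity
  have hRm : StrictMonoOn R (Ioi 0) :=
    strictMonoOn_of_deriv_pos (convex_Ioi 0)
      (fun s hs => (hRd s hs).continuousAt.continuousWithinAt) fun s hs => by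
        rw [interior_Ioi] at hs
        rw [(hRd s hs).deriv]; exact hR'0 s hs
  have hRc : ContinuousOn R (Ioi 0) := fun s hs =>
    (hRd s hs).continuousAt.continuousWithinAt
  have hR'c : ContinuousOn R' (Ioi 0) := by
    refine (hTc.add (continuousOn_id.mul hT'c)).div (continuousOn_const.mul hRc)
      fun s hs => ?_
    have := (hT s hs).1; have hs' : 0 < s := hs; positivity
  have hgauss : IntegrableOn (fun r : ℝ => exp (-(1 / 2) * r ^ 2)) (Ioi 0) :=
    (integrable_exp_neg_mul_sq (by norm_num)).integrableOn
  have hsub : R '' Ioi 0 ⊆ Ioi 0 := by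
    rintro _ ⟨s, hs, rfl⟩
    exact sqrt_pos.2 (mul_pos hs (hT s hs).1)
  set w : ℝ → ℝ := fun s => R' s * exp (-(1 / 2) * R s ^ 2) with hw
  have hcv := integral_image_eq_integral_abs_deriv_smul measurableSet_Ioi
    (fun s hs => (hRd s hs).hasDerivWithinAt) hRm.injOn (fun r : ℝ => exp (-(1 / 2) * r ^ 2))
  have hcvi := (integrableOn_image_iff_integrableOn_abs_deriv_smul measurableSet_Ioi
    (fun s hs => (hRd s hs).hasDerivWithinAt) hRm.injOn
    (fun r : ℝ => exp (-(1 / 2) * r ^ 2))).1 (hgauss.mono_set hsub)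
  have habs : EqOn (fun s => |R' s| • exp (-(1 / 2) * R s ^ 2)) w (Ioi 0) := fun s hs => by
    simp only [hw, smul_eq_mul, abs_of_pos (hR'0 s hs)]
  rw [setIntegral_congr_fun measurableSet_Ioi habs] at hcv
  have hwi : IntegrableOn w (Ioi 0) := hcvi.congr_fun habs measurableSet_Ioi
  have hwle : ∫ s in Ioi 0, w s ≤ √(π / 2) := by
    rw [← hcv]
    refine (setIntegral_mono_set hgauss (ae_of_all _ fun _ => (exp_pos _).le)
      hsub.eventuallyLE).trans_eq ?_
    rw [integral_gaussian_Ioi, div_eq_iff two_ne_zero, ← sqrt_sq (zero_le_two (α := ℝ)),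
      ← sqrt_mul (by positivity)]
    congr 1; ring_nf
  have hRsq : ∀ s ∈ Ioi (0 : ℝ), R s ^ 2 = s * T s := fun s hs =>
    sq_sqrt (mul_pos hs (hT s hs).1).le
  have hR'sq : ∀ s ∈ Ioi (0 : ℝ), R' s ^ 2 = (T s + s * T' s) ^ 2 / (4 * (s * T s)) :=
    fun s hs => by
      rw [hR', div_pow, mul_pow, sq_sqrt (mul_pos hs (hT s hs).1).le]; norm_num
  have hamgm : ∀ s ∈ Ioi (0 : ℝ), T' s ≤ R' s ^ 2 := fun s hs => by
    have h1 : 0 < s * T s := mul_pos hs (hT s hs).1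
    rw [hR'sq s hs, le_div_iff₀ (by positivity)]
    nlinarith [sq_nonneg (T s - s * T' s)]
  have hfT : ∀ s ∈ Ioi (0 : ℝ), f s * g (T s) ≤ K * exp (-(s * T s)) := fun s hs =>
    h s (T s) (le_of_lt hs) (hT s hs).1.le
  have husq : ∀ s, (f s * √(G / F)) ^ 2 = f s * g (T s) * T' s := fun s => by
    rw [mul_pow, sq_sqrt (by positivity), hT']
    have := (hg0 (T s)).ne'
    field_simp
  have hvsq : ∀ s ∈ Ioi (0 : ℝ), (√K * w s) ^ 2 = K * exp (-(s * T s)) * R' s ^ 2 :=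
    fun s hs => by
      rw [mul_pow, sq_sqrt hK.le, hw, mul_pow, ← exp_nat_mul, hRsq s hs]
      push_cast; ring_nf
  have hw0 : ∀ s ∈ Ioi (0 : ℝ), 0 < √K * w s := fun s hs => by
    have := hR'0 s hs; positivity
  have hu0 : ∀ s, 0 < f s * √(G / F) := fun s => by
    have := hf0 s; positivity
  have hle : ∀ s ∈ Ioi (0 : ℝ), f s * √(G / F) ≤ √K * w s := fun s hs => by
    rw [← sq_le_sq₀ (hu0 s).le (hw0 s hs).le, husq, hvsq s hs]
    exact mul_le_mul (hfT s hs) (hamgm s hs) (hT'0 s).le (by positivity)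
  have hinteg : F * √(G / F) ≤ √K * ∫ s in Ioi 0, w s := by
    rw [← integral_mul_const, ← integral_const_mul]
    exact setIntegral_mono_on (hfi.mul_const _) (hwi.const_mul _) measurableSet_Ioi hle
  have hsq : (F * √(G / F)) ^ 2 = F * G := by
    rw [mul_pow, sq_sqrt (by positivity)]; field_simp
  have hKsq : (√K * √(π / 2)) ^ 2 = K * (π / 2) := by
    rw [mul_pow, sq_sqrt hK.le, sq_sqrt (by positivity)]
  have hinteg' := hinteg.trans (mul_le_mul_of_nonneg_left hwle (sqrt_nonneg K))
  refine ⟨?_, fun heq => ?_⟩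
  · rw [← hsq, ← hKsq]
    gcongr
  have e1 : F * √(G / F) = √K * √(π / 2) := by
    rw [← sq_eq_sq₀ (by positivity) (by positivity), hsq, hKsq, heq]
  have e2 : ∫ s in Ioi 0, f s * √(G / F) = ∫ s in Ioi 0, √K * w s := by
    rw [integral_mul_const, integral_const_mul]
    exact le_antisymm hinteg (e1 ▸ mul_le_mul_of_nonneg_left hwle (sqrt_nonneg K))
  have hae := (integral_eq_iff_of_ae_le (hfi.mul_const _) (hwi.const_mul _)
    ((ae_restrict_iff' measurableSet_Ioi).2 (ae_of_all _ hle))).1 e2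
  have hev : EqOn (fun s => f s * √(G / F)) (fun s => √K * w s) (Ioi 0) := by
    refine Measure.eqOn_open_of_ae_eq hae isOpen_Ioi
      (hf.continuousOn.mul continuousOn_const) ?_
    exact continuousOn_const.mul (hR'c.mul
      (continuous_exp.comp_continuousOn (continuousOn_const.mul (hRc.pow 2))))
  have hboth : ∀ s ∈ Ioi (0 : ℝ), f s * g (T s) = K * exp (-(s * T s)) ∧ T s = s * T' s := by
    intro s hs
    have e : f s * g (T s) * T' s = K * exp (-(s * T s)) * R' s ^ 2 := by
      rw [← husq, ← hvsq s hs]; exact congrArg (· ^ 2) (hev hs)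
    have h1 := hfT s hs
    have h2 := hamgm s hs
    have h3 := hT'0 s
    have h4 : 0 < f s * g (T s) := mul_pos (hf0 s) (hg0 _)
    have h5 : T' s = R' s ^ 2 := by
      refine le_antisymm h2 (le_of_mul_le_mul_left ?_ h4)
      rw [e]
      exact mul_le_mul_of_nonneg_right h1 (by positivity)
    refine ⟨?_, ?_⟩
    · rw [h5] at e
      exact mul_right_cancel₀ (h5 ▸ h3).ne' e
    · have h1 : 0 < s * T s := mul_pos hs (hT s hs).1
      rw [hR'sq s hs, eq_div_iff (by positivity)] at h5
      have : (T s - s * T' s) ^ 2 = 0 := by linarith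
      linarith [pow_eq_zero_iff (two_ne_zero) |>.1 this]
  set κ := T 1 with hκ
  have hκ0 : 0 < κ := (hT 1 one_pos).1
  have hTlin : ∀ s ∈ Ioi (0 : ℝ), T s = κ * s := by
    intro s hs
    have hd : ∀ s ∈ Ioi (0 : ℝ), HasDerivAt (fun s => T s / s) 0 s := fun s hs => by
      refine ((hT s hs).2.div (hasDerivAt_id s) (ne_of_gt hs)).congr_deriv ?_
      have := (hboth s hs).2
      simp only [hT'] at this
      have e : f s * G / (F * g (T s)) * s - T s * 1 = 0 := by linarith
      simp only [id]
      rw [e, zero_div]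
    have := isOpen_Ioi.is_const_of_deriv_eq_zero (convex_Ioi (0 : ℝ)).isPreconnected
      (fun s hs => (hd s hs).differentiableAt.differentiableWithinAt)
      (fun s hs => (hd s hs).deriv) hs (mem_Ioi.2 (zero_lt_one (α := ℝ)))
    have hs' : s ≠ 0 := ne_of_gt hs
    simp only [div_one] at this
    rw [div_eq_iff hs'] at this
    exact this
  have key : ∀ t ∈ Ioi (0 : ℝ), f (κ⁻¹ * t) * g t = K * exp (-(κ⁻¹ * t ^ 2)) ∧
      g t = √(G / (F * κ) * K) * exp (-(κ⁻¹ * t ^ 2 / 2)) := by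
    intro t ht
    have hs : κ⁻¹ * t ∈ Ioi (0 : ℝ) := mul_pos (inv_pos.2 hκ0) ht
    obtain ⟨h1, h2⟩ := hboth _ hs
    have hTt : T (κ⁻¹ * t) = t := by rw [hTlin _ hs]; field_simp
    rw [hTt] at h1 h2
    have h3 : f (κ⁻¹ * t) * g t = K * exp (-(κ⁻¹ * t ^ 2)) := by rw [h1]; ring_nf
    refine ⟨h3, ?_⟩
    rw [← sq_eq_sq₀ (hg0 t).le (by positivity), mul_pow, sq_sqrt (by positivity),
      ← exp_nat_mul]
    have h4 : f (κ⁻¹ * t) * G = F * g t * κ := by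
      simp only [hT', hTt] at h2
      have := (hg0 t).ne'
      have ht' : t ≠ 0 := ne_of_gt ht
      generalize f (κ⁻¹ * t) = a at h2 ⊢
      field_simp at h2
      linarith
    have h5 : exp (((2 : ℕ) : ℝ) * -(κ⁻¹ * t ^ 2 / 2)) = exp (-(κ⁻¹ * t ^ 2)) := by
      congr 1; push_cast; ring
    rw [h5, mul_assoc, ← h3]
    generalize f (κ⁻¹ * t) = a at h4 ⊢
    field_simp
    linear_combination -(g t) * h4
  have cl : ∀ {p q : ℝ → ℝ}, Continuous p → Continuous q → EqOn p q (Ioi 0) →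
      ∀ t, 0 ≤ t → p t = q t := fun hp hq hpq t ht => by
    have := hpq.closure hp hq
    rw [closure_Ioi] at this
    exact this ht
  have k1 := cl (by fun_prop) (by fun_prop) fun t ht => (key t ht).1
  have k2 := cl (by fun_prop) (by fun_prop) fun t ht => (key t ht).2
  refine ⟨κ⁻¹, inv_pos.2 hκ0, fun t ht => ⟨?_, k1 t ht⟩⟩
  rw [k2 t ht, k2 0 le_rfl]
  simp

/-- Positive continuous functions decaying faster than every exponential. -/
structure RapidDecay {E : Type*} [NormedAddCommGroup E] (f : E → ℝ) : Prop where
  continuous : Continuous f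
  pos : ∀ x, 0 < f x
  decay : ∀ a : ℝ, ∃ C, ∀ x, f x ≤ C * exp (-(a * ‖x‖))

namespace RapidDecay

variable {E : Type*} [NormedAddCommGroup E] {f : E → ℝ}

theorem decay_pos (hf : RapidDecay f) (a : ℝ) :
    ∃ C, 0 < C ∧ ∀ x, f x ≤ C * exp (-(a * ‖x‖)) := by
  obtain ⟨C, hC⟩ := hf.decay a
  refine ⟨C, ?_, hC⟩
  have := (hf.pos 0).trans_le (hC 0)
  simpa using this

theorem const_mul (hf : RapidDecay f) {c : ℝ} (hc : 0 < c) : RapidDecay fun x => c * f x where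
  continuous := hf.continuous.const_mul c
  pos x := mul_pos hc (hf.pos x)
  decay a := by
    obtain ⟨C, hC⟩ := hf.decay a
    exact ⟨c * C, fun x => by rw [mul_assoc]; exact mul_le_mul_of_nonneg_left (hC x) hc.le⟩

theorem comp_add_left (hf : RapidDecay f) (z : E) : RapidDecay fun x => f (z + x) where
  continuous := hf.continuous.comp (continuous_const.add continuous_id)
  pos x := hf.pos _
  decay a := by
    obtain ⟨C, hC0, hC⟩ := hf.decay_pos |a|
    refine ⟨C * exp (|a| * ‖z‖), fun x => (hC _).trans ?_⟩
    rw [mul_assoc, ← exp_add]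
    gcongr
    have h1 : ‖x‖ ≤ ‖z + x‖ + ‖z‖ := by
      have := norm_sub_le (z + x) z
      rwa [add_sub_cancel_left] at this
    have h2 := mul_le_mul_of_nonneg_left h1 (abs_nonneg a)
    have h3 := mul_le_mul_of_nonneg_right (le_abs_self a) (norm_nonneg x)
    linarith

theorem comp_equiv [NormedSpace ℝ E] {E' : Type*} [NormedAddCommGroup E'] [NormedSpace ℝ E']
    (hf : RapidDecay f) (A : E' ≃L[ℝ] E) : RapidDecay fun x => f (A x) where
  continuous := hf.continuous.comp A.continuous
  pos x := hf.pos _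
  decay a := by
    obtain ⟨C, hC0, hC⟩ := hf.decay_pos (|a| * ‖(A.symm : E →L[ℝ] E')‖)
    refine ⟨C, fun x => (hC _).trans ?_⟩
    refine mul_le_mul_of_nonneg_left (exp_le_exp.2 (neg_le_neg ?_)) hC0.le
    have h1 : ‖x‖ ≤ ‖(A.symm : E →L[ℝ] E')‖ * ‖A x‖ := by
      simpa using (A.symm : E →L[ℝ] E').le_opNorm (A x)
    have h2 := mul_le_mul_of_nonneg_left h1 (abs_nonneg a)
    have h3 := mul_le_mul_of_nonneg_right (le_abs_self a) (norm_nonneg x)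
    linarith

theorem mul_exp [NormedSpace ℝ E] (hf : RapidDecay f) (l : E →L[ℝ] ℝ) :
    RapidDecay fun x => f x * exp (l x) where
  continuous := hf.continuous.mul (continuous_exp.comp l.continuous)
  pos x := mul_pos (hf.pos x) (exp_pos _)
  decay a := by
    obtain ⟨C, hC0, hC⟩ := hf.decay_pos (a + ‖l‖)
    refine ⟨C, fun x => ?_⟩
    have h1 : l x ≤ ‖l‖ * ‖x‖ := (le_abs_self _).trans (l.le_opNorm x)
    calc f x * exp (l x) ≤ C * exp (-((a + ‖l‖) * ‖x‖)) * exp (‖l‖ * ‖x‖) := by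
          gcongr; exact hC x
      _ = C * exp (-(a * ‖x‖)) := by rw [mul_assoc, ← exp_add]; ring_nf

theorem integrable_exp_neg_norm [NormedSpace ℝ E] [FiniteDimensional ℝ E] [MeasurableSpace E]
    [BorelSpace E] (μ : Measure E) [μ.IsAddHaarMeasure] :
    Integrable (fun x : E => exp (-‖x‖)) μ := by
  set N := Module.finrank ℝ E + 1 with hN
  have h : Integrable (fun x : E => (1 + ‖x‖) ^ (-(N : ℝ))) μ :=
    integrable_one_add_norm (by rw [hN]; push_cast; linarith)
  refine (h.const_mul ((N.factorial : ℝ) * exp 1)).mono'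
    (by fun_prop) (ae_of_all _ fun x => ?_)
  rw [norm_of_nonneg (exp_pos _).le, rpow_neg (by positivity), rpow_natCast, exp_neg,
    ← div_eq_mul_inv, le_div_iff₀ (by positivity), inv_mul_le_iff₀ (exp_pos _)]
  have := pow_div_factorial_le_exp (1 + ‖x‖) (by positivity) N
  rw [div_le_iff₀ (by positivity), exp_add] at this
  linarith

variable [NormedSpace ℝ E] [FiniteDimensional ℝ E] [MeasurableSpace E] [BorelSpace E]
  (μ : Measure E) [μ.IsAddHaarMeasure]

theorem integrable_of_norm_le {F : Type*} [NormedAddCommGroup F] (hf : RapidDecay f)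
    {h : E → F} (hh : AEStronglyMeasurable h μ) (a : ℝ)
    (hle : ∀ x, ‖h x‖ ≤ f x * exp (a * ‖x‖)) : Integrable h μ := by
  obtain ⟨C, hC0, hC⟩ := hf.decay_pos (1 + a)
  refine ((integrable_exp_neg_norm μ).const_mul C).mono' hh (ae_of_all _ fun x => ?_)
  calc ‖h x‖ ≤ C * exp (-((1 + a) * ‖x‖)) * exp (a * ‖x‖) :=
        (hle x).trans (by gcongr; exact hC x)
    _ = C * exp (-‖x‖) := by rw [mul_assoc, ← exp_add]; ring_nf

theorem integrable (hf : RapidDecay f) : Integrable f μ :=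
  hf.integrable_of_norm_le μ hf.continuous.aestronglyMeasurable 0 fun x => by
    simp [abs_of_pos (hf.pos x)]

theorem integrable_smul (hf : RapidDecay f) {F : Type*} [NormedAddCommGroup F] [NormedSpace ℝ F]
    (l : E →L[ℝ] F) : Integrable (fun x => f x • l x) μ := by
  have : SecondCountableTopologyEither E F := inferInstance
  refine hf.integrable_of_norm_le μ
    (hf.continuous.smul l.continuous).aestronglyMeasurable ‖l‖ fun x => ?_
  rw [norm_smul, norm_of_nonneg (hf.pos x).le]
  have h1 := l.le_opNorm x
  have h2 := add_one_le_exp (‖l‖ * ‖x‖)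
  exact mul_le_mul_of_nonneg_left (by linarith) (hf.pos x).le

theorem integral_pos (hf : RapidDecay f) : 0 < ∫ x, f x ∂μ := by
  rw [integral_pos_iff_support_of_nonneg (fun x => (hf.pos x).le) (hf.integrable μ)]
  have : Function.support f = univ := eq_univ_of_forall fun x => (hf.pos x).ne'
  rw [this]
  exact isOpen_univ.measure_pos μ univ_nonempty

end RapidDecay

namespace RapidDecay

variable {E : Type*} [NormedAddCommGroup E] {f : E × ℝ → ℝ}

theorem slice (hf : RapidDecay f) (x : E) : RapidDecay fun s : ℝ => f (x, s) where
  continuous := hf.continuous.comp (Continuous.prodMk_right x)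
  pos s := hf.pos _
  decay a := by
    obtain ⟨C, hC0, hC⟩ := hf.decay_pos |a|
    refine ⟨C, fun s => (hC _).trans ?_⟩
    refine mul_le_mul_of_nonneg_left (exp_le_exp.2 (neg_le_neg ?_)) hC0.le
    have h1 : ‖s‖ ≤ ‖(x, s)‖ := norm_snd_le (x, s)
    exact mul_le_mul (le_abs_self a) h1 (norm_nonneg _) (abs_nonneg _)

theorem fst_slice (hf : RapidDecay f) (s : ℝ) : RapidDecay fun x : E => f (x, s) where
  continuous := hf.continuous.comp (Continuous.prodMk_left s)
  pos s := hf.pos _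
  decay a := by
    obtain ⟨C, hC0, hC⟩ := hf.decay_pos |a|
    refine ⟨C, fun x => (hC _).trans ?_⟩
    refine mul_le_mul_of_nonneg_left (exp_le_exp.2 (neg_le_neg ?_)) hC0.le
    have h1 : ‖x‖ ≤ ‖(x, s)‖ := norm_fst_le (x, s)
    exact mul_le_mul (le_abs_self a) h1 (norm_nonneg _) (abs_nonneg _)

theorem integral_Ioi (hf : RapidDecay f) :
    RapidDecay fun x : E => ∫ s in Ioi (0 : ℝ), f (x, s) := by
  have hbound : ∀ a, 0 ≤ a → ∃ C, 0 < C ∧ ∀ (x : E) (s : ℝ),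
      f (x, s) ≤ C * exp (-(a * ‖x‖)) * exp (-‖s‖) := fun a ha => by
    obtain ⟨C, hC0, hC⟩ := hf.decay_pos (a + 1)
    refine ⟨C, hC0, fun x s => (hC _).trans ?_⟩
    rw [mul_assoc, ← exp_add]
    refine mul_le_mul_of_nonneg_left (exp_le_exp.2 ?_) hC0.le
    have h1 : ‖x‖ ≤ ‖(x, s)‖ := norm_fst_le (x, s)
    have h2 : ‖s‖ ≤ ‖(x, s)‖ := norm_snd_le (x, s)
    nlinarith
  have hexp : IntegrableOn (fun s : ℝ => exp (-‖s‖)) (Ioi 0) :=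
    (integrable_exp_neg_norm volume).integrableOn
  refine ⟨?_, fun x => ?_, fun a => ?_⟩
  · obtain ⟨C, hC0, hC⟩ := hbound 0 le_rfl
    refine continuous_of_dominated (bound := fun s => C * exp (-‖s‖))
      (fun x => (hf.slice x).continuous.aestronglyMeasurable) (fun x => ae_of_all _ fun s => ?_)
      (hexp.const_mul C) (ae_of_all _ fun s => (hf.fst_slice s).continuous)
    rw [norm_of_nonneg (hf.pos _).le]
    simpa using hC x s
  · rw [setIntegral_pos_iff_support_of_nonneg_ae (ae_of_all _ fun s => (hf.pos _).le)
      ((hf.slice x).integrable volume).integrableOn]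
    have : Function.support (fun s : ℝ => f (x, s)) = univ :=
      eq_univ_of_forall fun s => (hf.pos _).ne'
    simp [this]
  · obtain ⟨C, hC0, hC⟩ := hbound |a| (abs_nonneg a)
    refine ⟨C * ∫ s in Ioi (0 : ℝ), exp (-‖s‖), fun x => ?_⟩
    calc ∫ s in Ioi (0 : ℝ), f (x, s)
        ≤ ∫ s in Ioi (0 : ℝ), C * exp (-(|a| * ‖x‖)) * exp (-‖s‖) :=
          setIntegral_mono ((hf.slice x).integrable volume).integrableOn
            (hexp.const_mul _) (hC x)
      _ = C * (∫ s in Ioi (0 : ℝ), exp (-‖s‖)) * exp (-(|a| * ‖x‖)) := by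
          rw [integral_const_mul]; ring
      _ ≤ _ := by
          have : 0 ≤ ∫ s in Ioi (0 : ℝ), exp (-‖s‖) := integral_nonneg fun _ => (exp_pos _).le
          gcongr
          exact le_abs_self a

end RapidDecay

/-- `g` is, up to a factor, the exponential of a quadratic form. -/
def IsGaussian {E : Type*} [AddCommGroup E] [Module ℝ E] (g : E → ℝ) : Prop :=
  ∃ Q : QuadraticForm ℝ E, ∀ y, g y = g 0 * exp (-(Q y / 2))

/-- The functional Blaschke–Santaló inequality with constant `C` for functions of barycenter `0`,
including the description of the equality case. -/
def SantaloProperty {E : Type*} [NormedAddCommGroup E] [NormedSpace ℝ E] [MeasurableSpace E]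
    (μ : Measure E) (B : E → E → ℝ) (C : ℝ) : Prop :=
  ∀ f g : E → ℝ, RapidDecay f → RapidDecay g → ∫ x, f x • x ∂μ = 0 →
    (∀ x y, f x * g y ≤ exp (-(B x y))) →
    (∫ x, f x ∂μ) * (∫ y, g y ∂μ) ≤ C ∧
    ((∫ x, f x ∂μ) * (∫ y, g y ∂μ) = C →
      IsGaussian g ∧ ∀ y, ∃ x, f x * g y = exp (-(B x y)))

theorem nonpos_of_forall_le_sub_mul_sq {c d : ℝ} (h : ∀ T : ℝ, 0 ≤ T → 0 ≤ c - d * T ^ 2) :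
    d ≤ 0 := by
  by_contra! hd
  have h1 := h (√((|c| + 1) / d)) (sqrt_nonneg _)
  rw [sq_sqrt (by positivity), mul_div_cancel₀ _ hd.ne'] at h1
  linarith [le_abs_self c]

theorem inner_sub_add_mul_nonneg_of_eq {E : Type*} [NormedAddCommGroup E]
    [InnerProductSpace ℝ E] {f g : E × ℝ → ℝ} (hf : ∀ p, 0 < f p) (hg : ∀ p, 0 < g p)
    (hfg : ∀ p q : E × ℝ, f p * g q ≤ exp (-(⟪p.1, q.1⟫ + p.2 * q.2))) {p₁ p₂ q₁ q₂ : E × ℝ}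
    (h₁ : f p₁ * g q₁ = exp (-(⟪p₁.1, q₁.1⟫ + p₁.2 * q₁.2)))
    (h₂ : f p₂ * g q₂ = exp (-(⟪p₂.1, q₂.1⟫ + p₂.2 * q₂.2))) :
    0 ≤ ⟪p₁.1 - p₂.1, q₁.1 - q₂.1⟫ + (p₁.2 - p₂.2) * (q₁.2 - q₂.2) := by
  have h := mul_le_mul (hfg p₁ q₂) (hfg p₂ q₁) (mul_pos (hf _) (hg _)).le (exp_pos _).le
  have e : f p₁ * g q₂ * (f p₂ * g q₁) = f p₁ * g q₁ * (f p₂ * g q₂) := by ring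
  rw [e, h₁, h₂, ← exp_add, ← exp_add, exp_le_exp] at h
  rw [inner_sub_left, inner_sub_right, inner_sub_right]
  linarith

section

variable {E : Type*} [NormedAddCommGroup E] [NormedSpace ℝ E] [FiniteDimensional ℝ E]
  [MeasurableSpace E] [BorelSpace E] {μ : Measure E} [μ.IsAddHaarMeasure]

theorem IsGaussian.integral_smul_id_eq_zero {g : E → ℝ} (hg : IsGaussian g) :
    ∫ y, g y • y ∂μ = 0 := by
  obtain ⟨Q, hQ⟩ := hg
  have heven : ∀ y, g (-y) = g y := fun y => by rw [hQ, hQ y, QuadraticMap.map_neg]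
  have h := integral_neg_eq_self (fun y => g y • y) μ
  simp only [heven, smul_neg, integral_neg] at h
  have h2 : (2 : ℝ) • ∫ y, g y • y ∂μ = 0 := by
    rw [two_smul]; nth_rewrite 1 [← h]; exact neg_add_cancel _
  exact (smul_eq_zero.1 h2).resolve_left two_ne_zero

end

section

variable {E : Type*} [NormedAddCommGroup E] [InnerProductSpace ℝ E] [FiniteDimensional ℝ E]
  [MeasurableSpace E] [BorelSpace E] {μ : Measure E} [μ.IsAddHaarMeasure]

theorem SantaloProperty.half {C : ℝ} (hC : SantaloProperty μ (fun x y : E => ⟪x, y⟫) C)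
    {f g : E × ℝ → ℝ} (hf : RapidDecay f) (hg : RapidDecay g)
    (hfg : ∀ p q : E × ℝ, f p * g q ≤ exp (-(⟪p.1, q.1⟫ + p.2 * q.2)))
    (hbar : ∫ y, (∫ t in Ioi (0 : ℝ), g (y, t)) • y ∂μ = 0) :
    (∫ x, (∫ s in Ioi (0 : ℝ), f (x, s)) ∂μ) * (∫ y, (∫ t in Ioi (0 : ℝ), g (y, t)) ∂μ)
        ≤ C * (π / 2) ∧
    ((∫ x, (∫ s in Ioi (0 : ℝ), f (x, s)) ∂μ) * (∫ y, (∫ t in Ioi (0 : ℝ), g (y, t)) ∂μ)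
        = C * (π / 2) →
      ∃ Q : QuadraticForm ℝ E, ∃ κ > 0, ∀ y t, 0 ≤ t →
        g (y, t) = g (0, 0) * exp (-(Q y / 2)) * exp (-(κ * t ^ 2 / 2)) ∧
        ∃ p : E × ℝ, f p * g (y, t) = exp (-(⟪p.1, y⟫ + p.2 * t))) := by
  have hline : ∀ (x y : E) (s t : ℝ), 0 ≤ s → 0 ≤ t →
      f (x, s) * g (y, t) ≤ exp (-⟪x, y⟫) * exp (-(s * t)) := fun x y s t _ _ => by
    rw [← exp_add, ← neg_add]; exact hfg (x, s) (y, t)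
  have h1d := fun x y : E => integral_mul_integral_Ioi_le (hf.slice x).continuous
    (hg.slice y).continuous (hf.slice x).pos (hg.slice y).pos
    ((hf.slice x).integrable volume).integrableOn ((hg.slice y).integrable volume).integrableOn
    (exp_pos _) (hline x y)
  set F : E → ℝ := fun x => (2 / π) * ∫ s in Ioi (0 : ℝ), f (x, s) with hF
  set G : E → ℝ := fun y => ∫ t in Ioi (0 : ℝ), g (y, t) with hG
  have hπ := pi_pos
  have hFr : RapidDecay F := hf.integral_Ioi.const_mul (by positivity)
  have hGr : RapidDecay G := hg.integral_Ioi
  have hFe : ∀ x, ∫ s in Ioi (0 : ℝ), f (x, s) = (π / 2) * F x := fun x => by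
    rw [hF]; field_simp
  have hFG : ∀ x y, F x * G y ≤ exp (-⟪x, y⟫) := fun x y => by
    have := (h1d x y).1
    rw [hFe] at this
    have : (π / 2) * (F x * G y) ≤ (π / 2) * exp (-⟪x, y⟫) := by linarith
    exact le_of_mul_le_mul_left this (by positivity)
  have hGF : ∀ y x, G y * F x ≤ exp (-⟪y, x⟫) := fun y x => by
    rw [mul_comm, real_inner_comm]; exact hFG x y
  obtain ⟨hle, heq⟩ := hC G F hGr hFr hbar hGF
  simp only [hFe]
  rw [integral_const_mul]
  refine ⟨by nlinarith, fun h => ?_⟩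
  have h' : (∫ x, G x ∂μ) * ∫ y, F y ∂μ = C := by
    have : (π / 2) * ((∫ x, G x ∂μ) * ∫ y, F y ∂μ) = (π / 2) * C := by linarith
    exact mul_left_cancel₀ (by positivity) this
  obtain ⟨⟨Q, hQ⟩, hxy⟩ := (hC F G hFr hGr (heq h').1.integral_smul_id_eq_zero hFG).2
    ((mul_comm _ _).trans h')
  have hx : ∀ y, ∃ x, ∃ κ > 0, ∀ t, 0 ≤ t → g (y, t) = g (y, 0) * exp (-(κ * t ^ 2 / 2)) ∧
      f (x, κ * t) * g (y, t) = exp (-⟪x, y⟫) * exp (-(κ * t ^ 2)) := fun y => by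
    obtain ⟨x, hx⟩ := hxy y
    refine ⟨x, (h1d x y).2 ?_⟩
    rw [hFe, ← hx]; simp only [hG]; ring
  choose x κ hκ0 hκ using hx
  have hopt : ∀ y t, 0 ≤ t →
      f (x y, κ y * t) * g (y, t) = exp (-(⟪x y, y⟫ + κ y * t * t)) := fun y t ht => by
    rw [(hκ y t ht).2, ← exp_add]; ring_nf
  have hκle : ∀ y₁ y₂, κ y₂ ≤ κ y₁ := by
    intro y₁ y₂
    by_contra! hlt
    have h1 := hκ0 y₁
    have := nonpos_of_forall_le_sub_mul_sq (c := ⟪x y₁ - x y₂, y₁ - y₂⟫)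
      (d := (κ y₂ - κ y₁) ^ 2 / (4 * κ y₁)) fun T hT => by
        have hr : 0 ≤ (κ y₁ + κ y₂) / (2 * κ y₁) * T := by
          have := hκ0 y₂; positivity
        have := inner_sub_add_mul_nonneg_of_eq hf.pos hg.pos hfg
          (p₁ := (x y₁, κ y₁ * ((κ y₁ + κ y₂) / (2 * κ y₁) * T)))
          (q₁ := (y₁, (κ y₁ + κ y₂) / (2 * κ y₁) * T))
          (p₂ := (x y₂, κ y₂ * T)) (q₂ := (y₂, T)) (hopt _ _ hr) (hopt _ _ hT)
        refine this.trans_eq ?_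
        simp only
        field_simp
        ring
    have h2 : 0 < (κ y₂ - κ y₁) ^ 2 / (4 * κ y₁) := by
      have : 0 < κ y₂ - κ y₁ := sub_pos.2 hlt
      positivity
    linarith
  have hκc : ∀ y, κ y = κ 0 := fun y => le_antisymm (hκle _ _) (hκle _ _)
  have hg0 : ∀ y, g (y, 0) = g (0, 0) * exp (-(Q y / 2)) := by
    set J := ∫ t in Ioi (0 : ℝ), exp (-(κ 0 * t ^ 2 / 2)) with hJ
    have hGJ : ∀ y, G y = g (y, 0) * J := fun y => by
      rw [hG, hJ, ← integral_const_mul]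
      refine setIntegral_congr_fun measurableSet_Ioi fun t ht => ?_
      rw [← hκc y]
      exact (hκ y t (le_of_lt ht)).1
    have hJ0 : J ≠ 0 := fun h0 => (hGr.pos 0).ne' (by rw [hGJ, h0, mul_zero])
    intro y
    have := hQ y
    rw [hGJ, hGJ] at this
    exact mul_right_cancel₀ hJ0 (this.trans (by ring))
  refine ⟨Q, κ 0, hκ0 0, fun y t ht => ⟨?_, (x y, κ y * t), hopt y t ht⟩⟩
  rw [(hκ y t ht).1, hg0, hκc]

end

theorem RapidDecay.comp_reflect {E : Type*} [NormedAddCommGroup E] [NormedSpace ℝ E]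
    {f : E × ℝ → ℝ} (hf : RapidDecay f) :
    RapidDecay fun p : E × ℝ => f (p.1, -p.2) :=
  hf.comp_equiv ((ContinuousLinearEquiv.refl ℝ E).prodCongr (ContinuousLinearEquiv.neg ℝ))

section

variable {E : Type*} [NormedAddCommGroup E] [InnerProductSpace ℝ E] [FiniteDimensional ℝ E]
  [MeasurableSpace E] [BorelSpace E] {μ : Measure E} [μ.IsAddHaarMeasure]

theorem RapidDecay.integral_eq_add_reflect {f : E × ℝ → ℝ} (hf : RapidDecay f) :
    ∫ p, f p ∂(μ.prod volume) = (∫ x, (∫ s in Ioi (0 : ℝ), f (x, s)) ∂μ) +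
      ∫ x, (∫ s in Ioi (0 : ℝ), f (x, -s)) ∂μ := by
  rw [integral_prod _ (hf.integrable _), ← integral_add (hf.integral_Ioi.integrable μ)
    (hf.comp_reflect.integral_Ioi.integrable μ)]
  congr 1 with x
  have hi := (hf.slice x).integrable volume
  rw [integral_comp_neg_Ioi 0 (fun s => f (x, s)), neg_zero, add_comm,
    intervalIntegral.integral_Iic_add_Ioi hi.integrableOn hi.integrableOn]

theorem SantaloProperty.balanced {C : ℝ} (hC : SantaloProperty μ (fun x y : E => ⟪x, y⟫) C)
    {f g : E × ℝ → ℝ} (hf : RapidDecay f) (hg : RapidDecay g)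
    (hfg : ∀ p q : E × ℝ, f p * g q ≤ exp (-(⟪p.1, q.1⟫ + p.2 * q.2)))
    (hbar : ∫ y, (∫ t in Ioi (0 : ℝ), g (y, t)) • y ∂μ = 0)
    (hbar' : ∫ y, (∫ t in Ioi (0 : ℝ), g (y, -t)) • y ∂μ = 0)
    (hhalf : ∫ y, (∫ t in Ioi (0 : ℝ), g (y, t)) ∂μ = ∫ y, (∫ t in Ioi (0 : ℝ), g (y, -t)) ∂μ) :
    (∫ p, f p ∂(μ.prod volume)) * (∫ q, g q ∂(μ.prod volume)) ≤ 2 * π * C ∧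
    ((∫ p, f p ∂(μ.prod volume)) * (∫ q, g q ∂(μ.prod volume)) = 2 * π * C →
      ∃ Q : QuadraticForm ℝ E, ∃ κ : ℝ, ∀ y t,
        g (y, t) = g 0 * exp (-(Q y / 2)) * exp (-(κ * t ^ 2 / 2)) ∧
        ∃ p : E × ℝ, f p * g (y, t) = exp (-(⟪p.1, y⟫ + p.2 * t))) := by
  obtain ⟨h1, e1⟩ := hC.half hf hg hfg hbar
  obtain ⟨h2, e2⟩ := hC.half hf.comp_reflect hg.comp_reflect
    (fun p q => by simpa using hfg (p.1, -p.2) (q.1, -q.2)) hbar'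
  rw [hf.integral_eq_add_reflect, hg.integral_eq_add_reflect]
  dsimp only at h2 e2
  rw [← hhalf] at h2 e2
  rw [← hhalf]
  refine ⟨by linarith, fun h => ?_⟩
  obtain ⟨Q, κ, hκ, H⟩ := e1 (by linarith)
  obtain ⟨Q', κ', hκ', H'⟩ := e2 (by linarith)
  simp only [neg_zero] at H'
  have hcalc : ∀ {g : E × ℝ → ℝ} {Q : QuadraticForm ℝ E} {κ : ℝ}, (∀ y t, 0 ≤ t →
      g (y, t) = g (0, 0) * exp (-(Q y / 2)) * exp (-(κ * t ^ 2 / 2))) →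
      ∫ y, (∫ t in Ioi (0 : ℝ), g (y, t)) ∂μ = (∫ y, g (y, 0) ∂μ) * (√(π / (κ / 2)) / 2) := by
    intro g Q κ hgQ
    rw [← integral_mul_const]
    congr 1 with y
    rw [← integral_gaussian_Ioi, ← integral_const_mul]
    refine setIntegral_congr_fun measurableSet_Ioi fun t ht => ?_
    rw [hgQ y t (le_of_lt ht), hgQ y 0 le_rfl]
    simp only [ne_eq, OfNat.ofNat_ne_zero, not_false_eq_true, zero_pow, mul_zero, zero_div,
      neg_zero, exp_zero, mul_one]
    ring_nf
  have hκκ : κ = κ' := by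
    have k1 := hcalc fun y t ht => (H y t ht).1
    have k2 := hcalc (g := fun q => g (q.1, -q.2)) (Q := Q') (κ := κ')
      fun y t ht => by simpa using (H' y t ht).1
    have hpos : 0 < ∫ y, g (y, 0) ∂μ := (hg.fst_slice 0).integral_pos μ
    simp only [neg_zero] at k2
    rw [← hhalf, k1] at k2
    have k3 := mul_left_cancel₀ hpos.ne' k2
    have k4 : √(π / (κ / 2)) = √(π / (κ' / 2)) := by linarith
    rw [sqrt_inj (by positivity) (by positivity)] at k4
    have := pi_pos
    field_simp at k4
    exact k4.symm
  have hQQ : ∀ y, exp (-(Q y / 2)) = exp (-(Q' y / 2)) := fun y => by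
    have k1 := (H y 0 le_rfl).1
    have k2 := (H' y 0 le_rfl).1
    rw [neg_zero, k1] at k2
    simpa [(hg.pos (0, 0)).ne'] using k2
  refine ⟨Q, κ, fun y t => ?_⟩
  rcases le_total 0 t with ht | ht
  · exact H y t ht
  · obtain ⟨k1, p, hp⟩ := H' y (-t) (neg_nonneg.2 ht)
    rw [neg_neg, even_two.neg_pow, ← hQQ, ← hκκ] at k1
    refine ⟨k1, (p.1, -p.2), ?_⟩
    rw [neg_neg] at hp
    simpa using hp

end

theorem integrable_prod_restrict {E F : Type*} [MeasurableSpace E] {μ : Measure E} [SFinite μ]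
    [NormedAddCommGroup F] {h : E × ℝ → F}
    (hh : Integrable h (μ.prod volume)) (s : Set ℝ) :
    Integrable h (μ.prod (volume.restrict s)) := by
  rw [← Measure.restrict_univ (μ := μ), Measure.prod_restrict]
  exact hh.restrict

section

variable {E : Type*} [NormedAddCommGroup E] [InnerProductSpace ℝ E] [FiniteDimensional ℝ E]

/-- The shear `(y, t) ↦ (y + t v, t)`. -/
noncomputable def shear (v : E) : (E × ℝ) ≃L[ℝ] E × ℝ :=
  LinearEquiv.toContinuousLinearEquiv
    { toFun := fun p => (p.1 + p.2 • v, p.2)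
      invFun := fun p => (p.1 - p.2 • v, p.2)
      map_add' := fun p q => by
        ext <;> simp only [Prod.fst_add, Prod.snd_add, add_smul]
        abel
      map_smul' := fun c p => by ext <;> simp [mul_smul]
      left_inv := fun p => by simp
      right_inv := fun p => by simp }

/-- The inverse transpose `(x, s) ↦ (x, s - ⟪x, v⟫)` of a shear. -/
noncomputable def coshear (v : E) : (E × ℝ) ≃L[ℝ] E × ℝ :=
  LinearEquiv.toContinuousLinearEquiv
    { toFun := fun p => (p.1, p.2 - ⟪p.1, v⟫)
      invFun := fun p => (p.1, p.2 + ⟪p.1, v⟫)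
      map_add' := fun p q => by
        ext
        · rfl
        · simp only [Prod.fst_add, Prod.snd_add, inner_add_left]
          ring
      map_smul' := fun c p => by
        ext
        · rfl
        · simp only [Prod.smul_fst, Prod.smul_snd, real_inner_smul_left, smul_eq_mul,
            RingHom.id_apply]
          ring
      left_inv := fun p => by simp
      right_inv := fun p => by simp }

@[simp] theorem shear_apply (v : E) (p : E × ℝ) : shear v p = (p.1 + p.2 • v, p.2) := rfl

@[simp] theorem coshear_apply (v : E) (p : E × ℝ) : coshear v p = (p.1, p.2 - ⟪p.1, v⟫) := rfl

variable [MeasurableSpace E] [BorelSpace E] {μ : Measure E} [μ.IsAddHaarMeasure]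

theorem RapidDecay.integral_comp_shear {f : E × ℝ → ℝ} (hf : RapidDecay f) (v : E) :
    ∫ p, f (shear v p) ∂(μ.prod volume) = ∫ p, f p ∂(μ.prod volume) := by
  rw [integral_prod_symm _ ((hf.comp_equiv (shear v)).integrable _),
    integral_prod_symm _ (hf.integrable _)]
  congr 1 with t
  exact integral_add_right_eq_self (fun y => f (y, t)) (t • v)

theorem RapidDecay.integral_comp_coshear {f : E × ℝ → ℝ} (hf : RapidDecay f) (v : E) :
    ∫ p, f (coshear v p) ∂(μ.prod volume) = ∫ p, f p ∂(μ.prod volume) := by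
  rw [integral_prod _ ((hf.comp_equiv (coshear v)).integrable _),
    integral_prod _ (hf.integrable _)]
  congr 1 with x
  exact integral_sub_right_eq_self (μ := volume) (fun s => f (x, s)) ⟪x, v⟫

theorem RapidDecay.integral_smul_sheared {h : E × ℝ → ℝ} (hh : RapidDecay h) (z v : E) :
    ∫ y, (∫ t in Ioi (0 : ℝ), h (z + y + t • v, t)) • y ∂μ =
      (∫ t in Ioi (0 : ℝ), ∫ y, h (y, t) • y ∂μ) - (∫ t in Ioi (0 : ℝ), ∫ y, h (y, t) ∂μ) • z
        - (∫ t in Ioi (0 : ℝ), (∫ y, h (y, t) ∂μ) * t) • v := by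
  have hk : RapidDecay fun p : E × ℝ => h (z + p.1 + p.2 • v, p.2) := by
    have := (hh.comp_add_left (z, (0 : ℝ))).comp_equiv (shear v)
    simpa [add_assoc] using this
  have hinteg : ∀ {k : E × ℝ → ℝ}, RapidDecay k →
      Integrable (fun p : E × ℝ => k p • p.1) (μ.prod (volume.restrict (Ioi 0))) := fun hk =>
    integrable_prod_restrict (hk.integrable_smul _ (ContinuousLinearMap.fst ℝ E ℝ)) _
  have hinteg2 : Integrable (fun p : E × ℝ => h p * p.2) (μ.prod (volume.restrict (Ioi 0))) :=
    integrable_prod_restrict (hh.integrable_smul _ (ContinuousLinearMap.snd ℝ E ℝ)) _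
  have hinteg3 : Integrable (fun p : E × ℝ => h p) (μ.prod (volume.restrict (Ioi 0))) :=
    integrable_prod_restrict (hh.integrable _) _
  have hsmul : ∀ y, (∫ t in Ioi (0 : ℝ), h (z + y + t • v, t)) • y =
      ∫ t in Ioi (0 : ℝ), h (z + y + t • v, t) • y := fun y => (integral_smul_const _ _).symm
  simp_rw [hsmul]
  rw [integral_integral_swap (f := fun y t => h (z + y + t • v, t) • y) (hinteg hk)]
  have hinner : ∀ t : ℝ, ∫ y, h (z + y + t • v, t) • y ∂μ =
      (∫ y, h (y, t) • y ∂μ) - (∫ y, h (y, t) ∂μ) • z - ((∫ y, h (y, t) ∂μ) * t) • v := by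
    intro t
    have i1 := (hh.fst_slice t).integrable μ
    have i2 : Integrable (fun y => h (y, t) • y) μ :=
      (hh.fst_slice t).integrable_smul μ (ContinuousLinearMap.id ℝ E)
    rw [← integral_add_right_eq_self (fun y => h (y, t) • y) (z + t • v), mul_smul,
      ← integral_smul_const, ← integral_smul_const,
      ← integral_add_right_eq_self (fun y => h (y, t) • z) (z + t • v),
      ← integral_add_right_eq_self (fun y => h (y, t) • t • v) (z + t • v),
      ← integral_sub, ← integral_sub]
    · congr 1 with y
      rw [show z + y + t • v = y + (z + t • v) by abel, ← smul_sub, ← smul_sub]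
      congr 1; abel
    · exact ((i2.comp_add_right _)).sub ((i1.smul_const z).comp_add_right _)
    · exact (i1.smul_const (t • v)).comp_add_right _
    · exact i2.comp_add_right _
    · exact (i1.smul_const z).comp_add_right _
  simp_rw [hinner]
  have j1 : Integrable (fun t => ∫ y, h (y, t) • y ∂μ) (volume.restrict (Ioi 0)) :=
    (hinteg hh).integral_prod_right
  have j2 : Integrable (fun t => (∫ y, h (y, t) ∂μ) • z) (volume.restrict (Ioi 0)) :=
    hinteg3.integral_prod_right.smul_const z
  have j3 : Integrable (fun t => ((∫ y, h (y, t) ∂μ) * t) • v) (volume.restrict (Ioi 0)) := by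
    refine Integrable.smul_const ?_ v
    have := hinteg2.integral_prod_right
    simpa only [integral_mul_const] using this
  rw [integral_sub (f := fun t => (∫ y, h (y, t) • y ∂μ) - (∫ y, h (y, t) ∂μ) • z)
    (j1.sub j2) j3, integral_sub j1 j2, integral_smul_const, integral_smul_const]

theorem exists_integral_Ioi_eq_integral_Iic {γ : ℝ → ℝ} (hγ : Integrable γ)
    (h0 : ∀ t, 0 ≤ γ t) : ∃ t₀, ∫ t in Ioi t₀, γ t = ∫ t in Iic t₀, γ t := by
  have hcont : Continuous fun t => ∫ s in Iic t, γ s := by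
    have : (fun t => ∫ s in Iic t, γ s) =
        fun t => (∫ s in (0 : ℝ)..t, γ s) + ∫ s in Iic 0, γ s := by
      ext t
      rw [← intervalIntegral.integral_Iic_sub_Iic hγ.integrableOn hγ.integrableOn]; ring
    rw [this]
    exact (intervalIntegral.continuous_primitive (fun _ _ => hγ.intervalIntegrable) 0).add
      continuous_const
  have htot : ∀ t, (∫ s in Iic t, γ s) + ∫ s in Ioi t, γ s = ∫ s, γ s := fun t =>
    intervalIntegral.integral_Iic_add_Ioi hγ.integrableOn hγ.integrableOn
  have hI : 0 ≤ ∫ s, γ s := integral_nonneg h0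
  have htop : Tendsto (fun t => ∫ s in Iic t, γ s) atTop (𝓝 (∫ s, γ s)) := by
    have := (aecover_Iic (μ := volume) tendsto_id).integral_tendsto_of_countably_generated hγ
    simpa using this
  have hbot : Tendsto (fun t => ∫ s in Ioi t, γ s) atBot (𝓝 (∫ s, γ s)) := by
    have := (aecover_Ioi (μ := volume) tendsto_id).integral_tendsto_of_countably_generated hγ
    simpa using this
  rcases hI.eq_or_lt with h | h
  · refine ⟨0, ?_⟩
    have a1 : 0 ≤ ∫ s in Ioi (0 : ℝ), γ s := integral_nonneg h0
    have a2 : 0 ≤ ∫ s in Iic (0 : ℝ), γ s := integral_nonneg h0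
    have a3 := htot 0
    linarith
  · obtain ⟨a, ha⟩ := (htop.eventually_const_lt (half_lt_self h)).exists
    obtain ⟨b, hb⟩ := (hbot.eventually_const_lt (half_lt_self h)).exists
    obtain ⟨t, ht⟩ := mem_range_of_exists_le_of_exists_ge hcont (c := (∫ s, γ s) / 2)
      ⟨b, by linarith [htot b]⟩ ⟨a, ha.le⟩
    exact ⟨t, by simp only at ht; linarith [htot t]⟩

end

section

variable {E : Type*} [NormedAddCommGroup E] [InnerProductSpace ℝ E] [FiniteDimensional ℝ E]

theorem RapidDecay.sheared {h : E × ℝ → ℝ} (hh : RapidDecay h) (z v : E) :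
    RapidDecay fun p : E × ℝ => h (z + p.1 + p.2 • v, p.2) := by
  have := (hh.comp_add_left (z, (0 : ℝ))).comp_equiv (shear v)
  simpa [add_assoc] using this

variable [MeasurableSpace E] [BorelSpace E] {μ : Measure E} [μ.IsAddHaarMeasure]

theorem RapidDecay.integral_sheared {h : E × ℝ → ℝ} (hh : RapidDecay h) (z v : E) :
    ∫ y, (∫ t in Ioi (0 : ℝ), h (z + y + t • v, t)) ∂μ = ∫ t in Ioi (0 : ℝ), ∫ y, h (y, t) ∂μ := by
  rw [integral_integral_swap (f := fun y t => h (z + y + t • v, t))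
    (integrable_prod_restrict ((hh.sheared z v).integrable _) _)]
  congr 1 with t
  rw [← integral_add_right_eq_self (fun y => h (y, t)) (z + t • v)]
  congr 1 with y
  rw [show z + y + t • v = y + (z + t • v) by abel]

theorem RapidDecay.integral_Ioi_pos {h : E × ℝ → ℝ} (hh : RapidDecay h) :
    0 < ∫ t in Ioi (0 : ℝ), ∫ y, h (y, t) ∂μ := by
  rw [← hh.integral_sheared 0 0]
  simpa using hh.integral_Ioi.integral_pos μ

theorem RapidDecay.integral_Ioi_mul_pos {h : E × ℝ → ℝ} (hh : RapidDecay h) :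
    0 < ∫ t in Ioi (0 : ℝ), (∫ y, h (y, t) ∂μ) * t := by
  have hinteg2 : Integrable (fun p : E × ℝ => h p * p.2) (μ.prod (volume.restrict (Ioi 0))) :=
    integrable_prod_restrict (hh.integrable_smul _ (ContinuousLinearMap.snd ℝ E ℝ)) _
  have hi := hinteg2.integral_prod_right
  simp only [integral_mul_const] at hi
  have hp : ∀ t, 0 < ∫ y, h (y, t) ∂μ := fun t => (hh.fst_slice t).integral_pos μ
  rw [setIntegral_pos_iff_support_of_nonneg_ae _ hi]
  · have : Ioi (0 : ℝ) ⊆ Function.support (fun t => (∫ y, h (y, t) ∂μ) * t) ∩ Ioi 0 :=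
      fun t ht => ⟨(mul_pos (hp t) ht).ne', ht⟩
    exact (by simp : 0 < volume (Ioi (0 : ℝ))).trans_le (measure_mono this)
  · filter_upwards [ae_restrict_mem measurableSet_Ioi] with t ht
    exact (mul_pos (hp t) ht).le

/-- A translation and a shear place the barycenters of both halves of `g` on the axis, and make
the two halves have the same mass. -/
theorem RapidDecay.exists_balance {g : E × ℝ → ℝ} (hg : RapidDecay g) (μ : Measure E)
    [μ.IsAddHaarMeasure] : ∃ (z v : E) (t₀ : ℝ),
    ∫ y, (∫ t in Ioi (0 : ℝ), g ((z, t₀) + shear v (y, t))) • y ∂μ = 0 ∧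
    ∫ y, (∫ t in Ioi (0 : ℝ), g ((z, t₀) + shear v (y, -t))) • y ∂μ = 0 ∧
    ∫ y, (∫ t in Ioi (0 : ℝ), g ((z, t₀) + shear v (y, t))) ∂μ =
      ∫ y, (∫ t in Ioi (0 : ℝ), g ((z, t₀) + shear v (y, -t))) ∂μ := by
  obtain ⟨t₀, ht₀⟩ := exists_integral_Ioi_eq_integral_Iic
    (hg.integrable (μ.prod volume)).integral_prod_right
    fun t => integral_nonneg fun y => (hg.pos (y, t)).le
  have hh := hg.comp_add_left ((0 : E), t₀)
  have hh' := hh.comp_reflect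
  set h : E × ℝ → ℝ := fun p => g ((0, t₀) + p) with h_def
  set h' : E × ℝ → ℝ := fun p => h (p.1, -p.2) with h'_def
  have hM : ∫ t in Ioi (0 : ℝ), ∫ y, h (y, t) ∂μ = ∫ t in Ioi (0 : ℝ), ∫ y, h' (y, t) ∂μ := by
    have e1 : ∫ t in Ioi (0 : ℝ), ∫ y, h (y, t) ∂μ = ∫ t in Ioi t₀, ∫ y, g (y, t) ∂μ := by
      rw [← integral_indicator measurableSet_Ioi, ← integral_indicator measurableSet_Ioi,
        ← integral_add_left_eq_self ((Ioi t₀).indicator _) t₀]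
      congr 1 with t
      simp [indicator, h_def]
    have e2 : ∫ t in Iic (0 : ℝ), ∫ y, h (y, t) ∂μ = ∫ t in Iic t₀, ∫ y, g (y, t) ∂μ := by
      rw [← integral_indicator measurableSet_Iic, ← integral_indicator measurableSet_Iic,
        ← integral_add_left_eq_self ((Iic t₀).indicator _) t₀]
      congr 1 with t
      simp [indicator, h_def]
    rw [e1, ht₀, ← e2, ← neg_zero, ← integral_comp_neg_Ioi 0 (fun t => ∫ y, h (y, t) ∂μ), neg_zero]
  have hMpos := hh.integral_Ioi_pos (μ := μ)
  have hp := hh.integral_Ioi_mul_pos (μ := μ)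
  have hp' := hh'.integral_Ioi_mul_pos (μ := μ)
  have key := hh.integral_smul_sheared (μ := μ)
  have key' := hh'.integral_smul_sheared (μ := μ)
  have mass := hh.integral_sheared (μ := μ)
  have mass' := hh'.integral_sheared (μ := μ)
  rw [← hM] at key' mass'
  set M := ∫ t in Ioi (0 : ℝ), ∫ y, h (y, t) ∂μ
  set p := ∫ t in Ioi (0 : ℝ), (∫ y, h (y, t) ∂μ) * t
  set p' := ∫ t in Ioi (0 : ℝ), (∫ y, h' (y, t) ∂μ) * t
  set m := ∫ t in Ioi (0 : ℝ), ∫ y, h (y, t) • y ∂μ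
  set m' := ∫ t in Ioi (0 : ℝ), ∫ y, h' (y, t) • y ∂μ
  set v : E := (p + p')⁻¹ • (m - m') with v_def
  set z : E := M⁻¹ • (m - p • v) with z_def
  have hz : M • z = m - p • v := by rw [z_def, smul_inv_smul₀ hMpos.ne']
  have hv : p • v + p' • v = m - m' := by
    rw [← add_smul, v_def, smul_inv_smul₀ (by positivity)]
  have r1 : ∀ y t, g ((z, t₀) + shear v (y, t)) = h (z + y + t • v, t) := fun y t => by
    simp [h_def, add_assoc]
  have r2 : ∀ y t, g ((z, t₀) + shear v (y, -t)) = h' (z + y + t • (-v), t) := fun y t => by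
    simp [h_def, h'_def, add_assoc]
  refine ⟨z, v, t₀, ?_, ?_, ?_⟩
  · simp_rw [r1]
    rw [key z v, hz]
    abel
  · simp_rw [r2]
    rw [key' z (-v), hz, smul_neg, sub_neg_eq_add,
      show m' = m - (p • v + p' • v) by rw [hv, sub_sub_cancel]]
    abel
  · simp_rw [r2, r1]
    rw [mass, mass']

theorem SantaloProperty.prod_real {C : ℝ} (hC : SantaloProperty μ (fun x y : E => ⟪x, y⟫) C) :
    SantaloProperty (μ.prod (volume : Measure ℝ))
      (fun p q : E × ℝ => ⟪p.1, q.1⟫ + p.2 * q.2) (2 * π * C) := by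
  intro f g hf hg hbar hfg
  obtain ⟨z, v, t₀, b1, b2, b3⟩ := hg.exists_balance μ
  let l : E × ℝ →L[ℝ] ℝ := (innerSL ℝ z).comp (ContinuousLinearMap.fst ℝ E ℝ) +
    t₀ • ContinuousLinearMap.snd ℝ E ℝ
  have hl : ∀ p, l p = ⟪p.1, z⟫ + p.2 * t₀ := fun p => by
    simp [l, real_inner_comm, mul_comm]
  have hfl := hf.mul_exp l
  have hg' := (hg.comp_add_left (z, t₀)).comp_equiv (shear v)
  obtain ⟨hle, heq⟩ := hC.balanced (hfl.comp_equiv (coshear v)) hg' (fun p q => by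
    have h1 := hfg (coshear v p) ((z, t₀) + shear v q)
    calc _ = f (coshear v p) * g ((z, t₀) + shear v q) * exp (l (coshear v p)) := by ring
      _ ≤ _ := mul_le_mul_of_nonneg_right h1 (exp_pos _).le
      _ = _ := by
        rw [← exp_add, hl]
        congr 1
        simp only [coshear_apply, shear_apply, Prod.fst_add, Prod.snd_add, inner_add_right,
          real_inner_smul_right]
        ring) b1 b2 b3
  rw [hfl.integral_comp_coshear, (hg.comp_add_left (z, t₀)).integral_comp_shear,
    integral_add_left_eq_self g (z, t₀)] at hle heq
  have hgpos := hg.integral_pos (μ.prod volume)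
  have i1 := hf.integrable (μ.prod volume)
  have i2 : Integrable (fun p => f p * l p) (μ.prod volume) := hf.integrable_smul _ l
  have i3 := hfl.integrable (μ.prod volume)
  have hl0 : ∫ p, f p * l p ∂(μ.prod volume) = 0 := by
    have := l.integral_comp_comm (hf.integrable_smul (μ.prod volume) (ContinuousLinearMap.id ℝ _))
    simpa [hbar] using this
  have hdiff : ∫ p, f p * (exp (l p) - 1 - l p) ∂(μ.prod volume) =
      (∫ p, f p * exp (l p) ∂(μ.prod volume)) - ∫ p, f p ∂(μ.prod volume) := by
    have : ∀ p, f p * (exp (l p) - 1 - l p) = f p * exp (l p) - f p - f p * l p := fun p => by ring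
    simp_rw [this]
    rw [integral_sub (f := fun p => f p * exp (l p) - f p) (i3.sub i1) i2, integral_sub i3 i1, hl0,
      sub_zero]
  have hnn : ∀ p, 0 ≤ f p * (exp (l p) - 1 - l p) := fun p =>
    mul_nonneg (hf.pos p).le (by linarith [add_one_le_exp (l p)])
  have hff : ∫ p, f p ∂(μ.prod volume) ≤ ∫ p, f p * exp (l p) ∂(μ.prod volume) := by
    have : 0 ≤ ∫ p, f p * (exp (l p) - 1 - l p) ∂(μ.prod volume) := integral_nonneg hnn
    linarith
  refine ⟨(mul_le_mul_of_nonneg_right hff hgpos.le).trans hle, fun h => ?_⟩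
  have hff' : ∫ p, f p * exp (l p) ∂(μ.prod volume) = ∫ p, f p ∂(μ.prod volume) :=
    le_antisymm (le_of_mul_le_mul_right (hle.trans h.ge) hgpos) hff
  have hl00 : ∀ p, l p = 0 := fun p => by
    rw [hff', sub_self, integral_eq_zero_iff_of_nonneg hnn] at hdiff
    · have hc : Continuous fun p => f p * (exp (l p) - 1 - l p) :=
        hf.continuous.mul (((continuous_exp.comp l.continuous).sub continuous_const).sub
          l.continuous)
      have h0 := congrFun ((hc.ae_eq_iff_eq (μ.prod volume) continuous_zero).1 hdiff) p
      by_contra hne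
      have := add_one_lt_exp hne
      have := mul_pos (hf.pos p) (show 0 < exp (l p) - 1 - l p by linarith)
      simp only [Pi.zero_apply] at h0
      linarith
    · have : (fun p => f p * (exp (l p) - 1 - l p)) =
          fun p => f p * exp (l p) - f p - f p * l p := funext fun p => by ring
      rw [this]
      exact (i3.sub i1).sub i2
  have hz : z = 0 := by simpa [hl] using hl00 (z, 0)
  have ht : t₀ = 0 := by simpa [hl] using hl00 (0, 1)
  subst hz ht
  rw [hff'] at heq
  obtain ⟨Q, κ, H⟩ := heq h
  have hlz : ∀ p, exp (l p) = 1 := fun p => by rw [hl00, exp_zero]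
  have hz0 : ((0 : E), (0 : ℝ)) = 0 := rfl
  simp only [hlz, mul_one, hz0, zero_add, map_zero] at H
  refine ⟨⟨Q.comp (LinearMap.fst ℝ E ℝ - (LinearMap.snd ℝ E ℝ).smulRight v) +
    κ • (QuadraticMap.sq (R := ℝ)).comp (LinearMap.snd ℝ E ℝ), ?_⟩, ?_⟩
  · rintro ⟨y, t⟩
    have := (H (y - t • v) t).1
    simp only [shear_apply, sub_add_cancel] at this
    rw [this, mul_assoc, ← exp_add]
    congr 2
    simp
    ring
  · rintro ⟨y, t⟩
    obtain ⟨p, hp⟩ := (H (y - t • v) t).2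
    refine ⟨coshear v p, ?_⟩
    simp only [shear_apply, sub_add_cancel] at hp
    rw [hp]
    congr 1
    simp only [coshear_apply, inner_sub_right, real_inner_smul_right]
    ring

end

theorem SantaloProperty.transport {E E' : Type*} [NormedAddCommGroup E] [NormedSpace ℝ E]
    [MeasurableSpace E] [BorelSpace E] [NormedAddCommGroup E'] [NormedSpace ℝ E']
    [MeasurableSpace E'] [BorelSpace E'] {μ : Measure E} {ν : Measure E'}
    {B : E → E → ℝ} {B' : E' → E' → ℝ} {C : ℝ} (h : SantaloProperty μ B C) (e : E' ≃L[ℝ] E)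
    (he : MeasurePreserving e ν μ) (hB : ∀ x y, B (e x) (e y) = B' x y) :
    SantaloProperty ν B' C := by
  intro f g hf hg hbar hfg
  have hemb : MeasurableEmbedding e := e.toHomeomorph.measurableEmbedding
  have key : ∀ k : E' → ℝ, ∫ x, k (e.symm x) ∂μ = ∫ x, k x ∂ν := fun k => by
    rw [← he.integral_comp hemb]
    simp
  have hbar' : ∫ x, f (e.symm x) • x ∂μ = 0 := by
    rw [← he.integral_comp hemb]
    have := e.integral_comp_comm (μ := ν) fun x => f x • x
    simpa [hbar] using this
  obtain ⟨h1, h2⟩ := h (fun x => f (e.symm x)) (fun x => g (e.symm x)) (hf.comp_equiv e.symm)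
    (hg.comp_equiv e.symm) hbar' fun x y => by simpa [← hB] using hfg (e.symm x) (e.symm y)
  rw [key, key] at h1 h2
  refine ⟨h1, fun h => ?_⟩
  obtain ⟨⟨Q, hQ⟩, hp⟩ := h2 h
  refine ⟨⟨Q.comp (e : E' →ₗ[ℝ] E), fun y => by simpa using hQ (e y)⟩, fun y => ?_⟩
  obtain ⟨x, hx⟩ := hp (e y)
  exact ⟨e.symm x, by simpa [← hB] using hx⟩

theorem santaloProperty_of_subsingleton {E : Type*} [NormedAddCommGroup E] [InnerProductSpace ℝ E]
    [Subsingleton E] [MeasurableSpace E] {μ : Measure E} (hμ : μ univ = 1) :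
    SantaloProperty μ (fun x y : E => ⟪x, y⟫) 1 := by
  intro f g hf hg _ hfg
  have key : ∀ k : E → ℝ, ∫ x, k x ∂μ = k 0 := fun k => by
    have : k = fun _ => k 0 := funext fun x => by rw [Subsingleton.elim x 0]
    rw [this]
    simp [Measure.real, hμ]
  rw [key, key]
  have h0 := hfg 0 0
  simp only [inner_zero_left, neg_zero, exp_zero] at h0
  refine ⟨h0, fun h => ⟨⟨0, fun y => ?_⟩, fun y => ⟨0, ?_⟩⟩⟩
  · simp [Subsingleton.elim y 0]
  · rw [Subsingleton.elim y 0, h]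
    simp

/-- Splitting off the first coordinate of a Euclidean space. -/
noncomputable def EuclideanSpace.prodEquivSucc (n : ℕ) :
    EuclideanSpace ℝ (Fin (n + 1)) ≃L[ℝ] EuclideanSpace ℝ (Fin n) × ℝ :=
  LinearEquiv.toContinuousLinearEquiv
    { toFun := fun x => (WithLp.toLp 2 fun i => x i.succ, x 0)
      invFun := fun p => WithLp.toLp 2 (Fin.cons p.2 p.1 : Fin (n + 1) → ℝ)
      map_add' := fun _ _ => rfl
      map_smul' := fun _ _ => rfl
      left_inv := fun x => by
        ext i
        refine Fin.cases ?_ (fun i => ?_) i <;> simp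
      right_inv := fun p => by simp }

theorem EuclideanSpace.measurePreserving_prodEquivSucc (n : ℕ) :
    MeasurePreserving (EuclideanSpace.prodEquivSucc n) volume (volume.prod volume) := by
  have h1 := PiLp.volume_preserving_ofLp (Fin (n + 1))
  have h2 := volume_preserving_piFinSuccAbove (fun _ : Fin (n + 1) => ℝ) 0
  have h3 := (MeasurePreserving.id (volume : Measure ℝ)).prod (PiLp.volume_preserving_toLp (Fin n))
  exact Measure.measurePreserving_swap.comp (h3.comp (h2.comp h1))

theorem santaloProperty_euclideanSpace (n : ℕ) :
    SantaloProperty (volume : Measure (EuclideanSpace ℝ (Fin n))) (fun x y => ⟪x, y⟫)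
      ((2 * π) ^ n) := by
  induction n with
  | zero =>
    rw [pow_zero]
    refine santaloProperty_of_subsingleton ?_
    rw [volume_euclideanSpace_eq_dirac, Measure.dirac_apply_of_mem (mem_univ _)]
  | succ n ih =>
    rw [pow_succ']
    refine ih.prod_real.transport (EuclideanSpace.prodEquivSucc n)
      (EuclideanSpace.measurePreserving_prodEquivSucc n) fun x y => ?_
    rw [PiLp.inner_apply x y, Fin.sum_univ_succ, add_comm]
    exact congrArg₂ (· + ·) (mul_comm _ _) (PiLp.inner_apply _ _)

theorem integrable_mul_exp_neg_half_sq : Integrable fun r : ℝ => r * exp (-(r ^ 2 / 2)) := by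
  have := integrable_mul_exp_neg_mul_sq (b := 1 / 2) (by norm_num)
  refine this.congr (ae_of_all _ fun r => ?_)
  simp only
  congr 2
  ring

theorem integral_Ici_mul_exp_neg_half_sq (a : ℝ) :
    ∫ r in Ici a, r * exp (-(r ^ 2 / 2)) = exp (-(a ^ 2 / 2)) := by
  rw [integral_Ici_eq_integral_Ioi]
  have hd : ∀ x ∈ Ici a, HasDerivAt (fun r : ℝ => -exp (-(r ^ 2 / 2))) (x * exp (-(x ^ 2 / 2))) x :=
    fun x _ => by
      have h1 := ((((hasDerivAt_id x).pow 2).div_const 2).neg.exp).neg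
      convert! h1 using 1
      simp
      ring
  have ht : Tendsto (fun r : ℝ => -exp (-(r ^ 2 / 2))) atTop (𝓝 0) := by
    rw [← neg_zero]
    refine (tendsto_exp_atBot.comp (tendsto_neg_atTop_atBot.comp ?_)).neg
    exact (tendsto_pow_atTop two_ne_zero).atTop_div_const two_pos
  rw [integral_Ioi_of_hasDerivAt_of_tendsto' hd integrable_mul_exp_neg_half_sq.integrableOn ht]
  ring

section

variable {E : Type*} [NormedAddCommGroup E] [NormedSpace ℝ E] [FiniteDimensional ℝ E]
  [MeasurableSpace E] [BorelSpace E] {μ : Measure E} [μ.IsAddHaarMeasure]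

/-- Integration of a homogeneous function against the Gaussian density attached to a
gauge reduces to integration over the unit ball of the gauge. -/
theorem integral_exp_neg_half_sq_smul {F : Type*} [NormedAddCommGroup F] [NormedSpace ℝ F]
    [CompleteSpace F]
    {N : E → ℝ} (hN : Continuous N) (hN0 : ∀ x, 0 ≤ N x)
    (hNs : ∀ r : ℝ, 0 < r → ∀ x, N (r • x) = r * N x) {φ : E → F} (hφ : Continuous φ)
    (hinteg : Integrable (fun x => exp (-(N x ^ 2 / 2)) • φ x) μ) (k : ℕ)
    (hφs : ∀ r : ℝ, 0 < r → ∀ x, φ (r • x) = r ^ k • φ x) :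
    ∫ x, exp (-(N x ^ 2 / 2)) • φ x ∂μ =
      (∫ r in Ioi (0 : ℝ), r * exp (-(r ^ 2 / 2)) * (r ^ Module.finrank ℝ E * r ^ k)) •
        ∫ x in {x | N x ≤ 1}, φ x ∂μ := by
  let F₀ : E × ℝ → F := {p : E × ℝ | N p.1 ≤ p.2}.indicator
    fun p => (p.2 * exp (-(p.2 ^ 2 / 2))) • φ p.1
  have hcl : IsClosed {p : E × ℝ | N p.1 ≤ p.2} :=
    isClosed_le (hN.comp continuous_fst) continuous_snd
  have hF₀x : ∀ x, (fun r => F₀ (x, r)) =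
      (Ici (N x)).indicator fun r => (r * exp (-(r ^ 2 / 2))) • φ x := fun x => rfl
  have hF₀r : ∀ r, (fun x => F₀ (x, r)) =
      {x | N x ≤ r}.indicator fun x => (r * exp (-(r ^ 2 / 2))) • φ x := fun r => rfl
  have hi1 : ∀ x, Integrable (fun r => F₀ (x, r)) := fun x => by
    rw [hF₀x]
    exact (integrable_mul_exp_neg_half_sq.smul_const (φ x)).indicator measurableSet_Ici
  have hi2 : ∀ x, ∫ r, F₀ (x, r) = exp (-(N x ^ 2 / 2)) • φ x := fun x => by
    rw [hF₀x, integral_indicator measurableSet_Ici, integral_smul_const,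
      integral_Ici_mul_exp_neg_half_sq]
  have hi3 : ∀ x, ∫ r, ‖F₀ (x, r)‖ = ‖exp (-(N x ^ 2 / 2)) • φ x‖ := fun x => by
    have : (fun r => ‖F₀ (x, r)‖) = (Ici (N x)).indicator fun r =>
        (r * exp (-(r ^ 2 / 2))) * ‖φ x‖ := by
      ext r
      rw [congrFun (hF₀x x) r, norm_indicator_eq_indicator_norm]
      refine congrFun (indicator_congr fun r hr => ?_) r
      rw [norm_smul, norm_of_nonneg (mul_nonneg ((hN0 x).trans hr) (exp_pos _).le)]
    rw [this, integral_indicator measurableSet_Ici, integral_mul_const,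
      integral_Ici_mul_exp_neg_half_sq, norm_smul, norm_of_nonneg (exp_pos _).le]
  have hmeas : AEStronglyMeasurable F₀ (μ.prod volume) := by
    refine AEStronglyMeasurable.indicator ?_ hcl.measurableSet
    have : Continuous fun p : E × ℝ => (p.2 * exp (-(p.2 ^ 2 / 2))) • φ p.1 := by fun_prop
    exact this.aestronglyMeasurable
  have hInt : Integrable F₀ (μ.prod volume) := by
    rw [integrable_prod_iff hmeas]
    refine ⟨ae_of_all _ hi1, ?_⟩
    simp_rw [hi3]
    exact hinteg.norm
  have hslice : ∀ r, 0 < r → ∫ x, F₀ (x, r) ∂μ =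
      (r * exp (-(r ^ 2 / 2)) * (r ^ Module.finrank ℝ E * r ^ k)) •
        ∫ x in {x | N x ≤ 1}, φ x ∂μ := fun r hr => by
    have hset : {x | N x ≤ r} = r • {x | N x ≤ 1} := by
      ext x
      rw [mem_smul_set_iff_inv_smul_mem₀ hr.ne', mem_ofPred_eq, mem_ofPred_eq,
        hNs _ (inv_pos.2 hr), inv_mul_le_iff₀ hr, mul_one]
    rw [hF₀r, integral_indicator (isClosed_le hN continuous_const).measurableSet,
      integral_smul, mul_smul (r * exp _), mul_smul (r ^ _)]
    congr 1
    have h1 := Measure.setIntegral_comp_smul_of_pos μ φ {x | N x ≤ 1} hr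
    simp_rw [hφs r hr] at h1
    rw [integral_smul] at h1
    rw [h1, hset, smul_inv_smul₀ (by positivity)]
  have hneg : ∀ r, r ∉ Ici (0 : ℝ) → ∫ x, F₀ (x, r) ∂μ = 0 := fun r hr => by
    have : {x | N x ≤ r} = ∅ := by
      ext x
      simp only [mem_Ici, not_le] at hr
      simpa using hr.trans_le (hN0 x)
    rw [hF₀r, this, indicator_empty, integral_zero]
  simp_rw [← hi2]
  rw [integral_integral_swap (f := fun x r => F₀ (x, r)) hInt,
    ← setIntegral_eq_integral_of_forall_compl_eq_zero hneg, integral_Ici_eq_integral_Ioi,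
    setIntegral_congr_fun measurableSet_Ioi hslice, integral_smul_const]

end

/-- The density `exp (-‖x‖_L² / 2)` attached to the gauge of `L`. -/
noncomputable def gaugeDensity {E : Type*} [AddCommGroup E] [Module ℝ E] (L : Set E) (x : E) : ℝ :=
  exp (-(gauge L x ^ 2 / 2))

section

variable {E : Type*} [NormedAddCommGroup E] [NormedSpace ℝ E] {L : Set E}

theorem exists_norm_le_mul_gauge (hLc : IsCompact L) (hL0 : L ∈ 𝓝 0) :
    ∃ R : ℝ, 0 < R ∧ ∀ x, ‖x‖ ≤ R * gauge L x := by
  obtain ⟨R, hR0, hR⟩ := hLc.isBounded.exists_pos_norm_le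
  refine ⟨R, hR0, fun x => ?_⟩
  have := le_gauge_of_subset_closedBall (x := x) (absorbent_nhds_zero hL0) hR0.le
    fun y hy => by simpa using hR y hy
  rwa [div_le_iff₀' hR0] at this

theorem setOf_gauge_le_one (hL : Convex ℝ L) (hLc : IsCompact L) (hL0 : L ∈ 𝓝 0) :
    {x | gauge L x ≤ 1} = L := by
  ext x
  rw [mem_ofPred_eq, gauge_le_one_iff_mem_closure hL hL0, hLc.isClosed.closure_eq]

theorem rapidDecay_gaugeDensity (hL : Convex ℝ L) (hLc : IsCompact L) (hL0 : L ∈ 𝓝 0) :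
    RapidDecay (gaugeDensity L) where
  continuous := by
    have := continuous_gauge hL hL0
    unfold gaugeDensity
    fun_prop
  pos x := exp_pos _
  decay a := by
    obtain ⟨R, hR0, hR⟩ := exists_norm_le_mul_gauge hLc hL0
    refine ⟨exp ((a * R) ^ 2 / 2), fun x => ?_⟩
    rw [gaugeDensity, ← exp_add, exp_le_exp]
    have h1 : a * ‖x‖ ≤ |a| * (R * gauge L x) :=
      mul_le_mul (le_abs_self a) (hR x) (norm_nonneg x) (abs_nonneg a)
    have h2 : (a * R) ^ 2 = (|a| * R) ^ 2 := by rw [mul_pow, mul_pow, sq_abs]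
    nlinarith [sq_nonneg (|a| * R - gauge L x)]

variable [FiniteDimensional ℝ E] [MeasurableSpace E] [BorelSpace E] {μ : Measure E}
  [μ.IsAddHaarMeasure]

theorem integral_gaugeDensity_smul {F : Type*} [NormedAddCommGroup F] [NormedSpace ℝ F]
    [CompleteSpace F] (hL : Convex ℝ L) (hLc : IsCompact L) (hL0 : L ∈ 𝓝 0) {φ : E → F}
    (hφ : Continuous φ) (hinteg : Integrable (fun x => gaugeDensity L x • φ x) μ) (k : ℕ)
    (hφs : ∀ r : ℝ, 0 < r → ∀ x, φ (r • x) = r ^ k • φ x) :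
    ∫ x, gaugeDensity L x • φ x ∂μ =
      (∫ r in Ioi (0 : ℝ), r * exp (-(r ^ 2 / 2)) * (r ^ Module.finrank ℝ E * r ^ k)) •
        ∫ x in L, φ x ∂μ := by
  have := integral_exp_neg_half_sq_smul (continuous_gauge hL hL0) gauge_nonneg
    (fun r hr x => gauge_smul_of_nonneg hr.le x) hφ hinteg k hφs
  rwa [setOf_gauge_le_one hL hLc hL0] at this

theorem integral_gaugeDensity (hL : Convex ℝ L) (hLc : IsCompact L) (hL0 : L ∈ 𝓝 0) :
    ∫ x, gaugeDensity L x ∂μ =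
      (∫ r in Ioi (0 : ℝ), r * exp (-(r ^ 2 / 2)) * (r ^ Module.finrank ℝ E * r ^ 0)) *
        μ.real L := by
  have := integral_gaugeDensity_smul (μ := μ) hL hLc hL0 (φ := fun _ => (1 : ℝ)) continuous_const
    (by simpa using (rapidDecay_gaugeDensity hL hLc hL0).integrable μ) 0 (by simp)
  simpa using this

theorem integral_gaugeDensity_smul_id (hL : Convex ℝ L) (hLc : IsCompact L) (hL0 : L ∈ 𝓝 0)
    (hbar : ∫ x in L, x ∂μ = 0) : ∫ x, gaugeDensity L x • x ∂μ = 0 := by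
  have := integral_gaugeDensity_smul (μ := μ) hL hLc hL0 (φ := fun x : E => x) continuous_id
    ((rapidDecay_gaugeDensity hL hLc hL0).integrable_smul μ (ContinuousLinearMap.id ℝ E)) 1
    (by simp)
  rw [this, hbar, smul_zero]

end

section

variable {E : Type*} [NormedAddCommGroup E] [InnerProductSpace ℝ E]

/-- The polar body of `L`. -/
def polarBody (L : Set E) : Set E := {y | ∀ z ∈ L, ⟪y, z⟫ ≤ 1}

theorem convex_polarBody (L : Set E) : Convex ℝ (polarBody L) := by
  intro x hx y hy a b ha hb hab z hz
  rw [inner_add_left, real_inner_smul_left, real_inner_smul_left]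
  nlinarith [hx z hz, hy z hz]

theorem isClosed_polarBody (L : Set E) : IsClosed (polarBody L) := by
  have : polarBody L = ⋂ z ∈ L, {y | ⟪y, z⟫ ≤ 1} := by
    ext y
    simp [polarBody]
  rw [this]
  exact isClosed_biInter fun z _ => isClosed_le (by fun_prop) continuous_const

theorem isCompact_polarBody [FiniteDimensional ℝ E] {L : Set E} (hL0 : L ∈ 𝓝 0) :
    IsCompact (polarBody L) := by
  obtain ⟨ε, hε, hsub⟩ := Metric.nhds_basis_closedBall.mem_iff.1 hL0
  refine Metric.isCompact_of_isClosed_isBounded (isClosed_polarBody L)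
    (isBounded_iff_forall_norm_le.2 ⟨1 / ε, fun y hy => ?_⟩)
  rcases eq_or_ne y 0 with rfl | hy0
  · simpa using hε.le
  have hn := norm_pos_iff.2 hy0
  have := hy ((ε / ‖y‖) • y) (hsub (by
    rw [mem_closedBall_zero_iff, norm_smul, norm_div, norm_norm, div_mul_cancel₀ _ hn.ne',
      norm_of_nonneg hε.le]))
  rw [real_inner_smul_right, real_inner_self_eq_norm_sq] at this
  rw [le_div_iff₀ hε]
  calc _ = ε / ‖y‖ * ‖y‖ ^ 2 := by field_simp
    _ ≤ 1 := this

theorem polarBody_mem_nhds {L : Set E} (hL : Bornology.IsBounded L) : polarBody L ∈ 𝓝 0 := by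
  obtain ⟨R, hR0, hR⟩ := hL.exists_pos_norm_le
  filter_upwards [Metric.closedBall_mem_nhds (0 : E) (inv_pos.2 hR0)] with y hy z hz
  rw [mem_closedBall_zero_iff] at hy
  calc ⟪y, z⟫ ≤ ‖y‖ * ‖z‖ := real_inner_le_norm y z
    _ ≤ R⁻¹ * R := mul_le_mul hy (hR z hz) (norm_nonneg z) (inv_pos.2 hR0).le
    _ = 1 := inv_mul_cancel₀ hR0.ne'

theorem inner_le_gauge_mul_gauge_polarBody [FiniteDimensional ℝ E] {L : Set E} (hL : Convex ℝ L)
    (hLc : IsCompact L) (hL0 : L ∈ 𝓝 0) (x y : E) :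
    ⟪x, y⟫ ≤ gauge L x * gauge (polarBody L) y := by
  have hP := convex_polarBody L
  have hPc := isCompact_polarBody hL0
  have hP0 := polarBody_mem_nhds hLc.isBounded
  have key : ∀ {S : Set E}, Convex ℝ S → IsCompact S → S ∈ 𝓝 0 → ∀ x,
      ∃ u ∈ S, x = gauge S x • u := fun {S} hS hSc hS0 x => by
    rcases eq_or_ne (gauge S x) 0 with h | h
    · obtain ⟨R, -, hR⟩ := exists_norm_le_mul_gauge hSc hS0
      refine ⟨0, mem_of_mem_nhds hS0, ?_⟩
      have := hR x
      rw [h, mul_zero] at this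
      simpa using this
    · refine ⟨(gauge S x)⁻¹ • x, ?_, (smul_inv_smul₀ h x).symm⟩
      refine (setOf_gauge_le_one hS hSc hS0).subset ?_
      rw [mem_ofPred_eq, gauge_smul_of_nonneg (inv_nonneg.2 (gauge_nonneg x)), smul_eq_mul,
        inv_mul_cancel₀ h]
  obtain ⟨u, hu, hxu⟩ := key hL hLc hL0 x
  obtain ⟨w, hw, hyw⟩ := key hP hPc hP0 y
  have h1 : ⟪x, y⟫ = gauge L x * gauge (polarBody L) y * ⟪w, u⟫ := by
    conv_lhs => rw [hxu, hyw]
    rw [real_inner_smul_left, real_inner_smul_right, real_inner_comm, mul_assoc]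
  rw [h1]
  exact mul_le_of_le_one_right (mul_nonneg (gauge_nonneg _) (gauge_nonneg _)) (hw u hu)

theorem gaugeDensity_mul_gaugeDensity_polarBody_le [FiniteDimensional ℝ E] {L : Set E}
    (hL : Convex ℝ L) (hLc : IsCompact L) (hL0 : L ∈ 𝓝 0) (x y : E) :
    gaugeDensity L x * gaugeDensity (polarBody L) y ≤ exp (-⟪x, y⟫) := by
  rw [gaugeDensity, gaugeDensity, ← exp_add, exp_le_exp]
  have := inner_le_gauge_mul_gauge_polarBody hL hLc hL0 x y
  nlinarith [sq_nonneg (gauge L x - gauge (polarBody L) y)]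

end

section

variable {E : Type*} [NormedAddCommGroup E] [NormedSpace ℝ E] [FiniteDimensional ℝ E]
  [MeasurableSpace E] [BorelSpace E] {μ : Measure E} [μ.IsAddHaarMeasure]

theorem Convex.setAverage_mem_interior {K : Set E} (hK : Convex ℝ K) (hKc : IsCompact K)
    (hKi : (interior K).Nonempty) : ⨍ x in K, x ∂μ ∈ interior K := by
  obtain ⟨x₀, hx₀⟩ := hKi
  obtain ⟨ε, hε, hsub⟩ := Metric.nhds_basis_closedBall.mem_iff.1 (isOpen_interior.mem_nhds hx₀)
  have hsubK := hsub.trans interior_subset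
  have hfin : IsFiniteMeasure (μ.restrict K) := ⟨by simpa using hKc.measure_lt_top⟩
  have hpos : μ (Metric.closedBall x₀ ε) ≠ 0 := (Metric.measure_closedBall_pos μ x₀ hε).ne'
  have hinteg : IntegrableOn (fun x => x) K μ := continuous_id.continuousOn.integrableOn_compact hKc
  have hr : (μ.restrict K).restrict (Metric.closedBall x₀ ε) =
      μ.restrict (Metric.closedBall x₀ ε) := by
    rw [Measure.restrict_restrict Metric.isClosed_closedBall.measurableSet,
      inter_eq_left.2 hsubK]
  refine hK.average_mem_interior_of_set (t := Metric.closedBall x₀ ε) ?_ ?_ hinteg (hsub ?_)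
  · rwa [Measure.restrict_apply Metric.isClosed_closedBall.measurableSet, inter_eq_left.2 hsubK]
  · exact ae_restrict_mem hKc.isClosed.measurableSet
  · rw [hr]
    exact (convex_closedBall x₀ ε).set_average_mem Metric.isClosed_closedBall hpos
      (isCompact_closedBall x₀ ε).measure_lt_top.ne
      (ae_restrict_mem Metric.isClosed_closedBall.measurableSet) (hinteg.mono_set hsubK)

end

/-- A positive definite quadratic form is the square of the norm in suitable coordinates. -/
theorem QuadraticForm.exists_linearEquiv_eq_norm_sq {n : ℕ}
    {Q : QuadraticForm ℝ (EuclideanSpace ℝ (Fin n))} (hQ : ∀ x, x ≠ 0 → 0 < Q x) :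
    ∃ A : EuclideanSpace ℝ (Fin n) ≃ₗ[ℝ] EuclideanSpace ℝ (Fin n), ∀ x, Q x = ‖A x‖ ^ 2 := by
  obtain ⟨w, hw, ⟨e⟩⟩ := Q.equivalent_one_zero_neg_one_weighted_sum_squared
  have hpos : ∀ i, w i = 1 := fun i => by
    have h1 : 0 < Q (e.symm (Pi.single i 1)) := hQ _ fun h => by
      have h2 := congrArg e h
      simp at h2
    rw [← e.map_app, e.apply_symm_apply, QuadraticMap.weightedSumSquares_apply] at h1
    simp [Pi.single_apply] at h1
    rcases hw i with h | h | h <;> linarith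
  have hn : Module.finrank ℝ (EuclideanSpace ℝ (Fin n)) = n := by simp
  let r := LinearEquiv.funCongrLeft ℝ ℝ (finCongr hn.symm)
  refine ⟨(e.toLinearEquiv.trans r).trans (WithLp.linearEquiv 2 ℝ (Fin n → ℝ)).symm, fun x => ?_⟩
  rw [← e.map_app, QuadraticMap.weightedSumSquares_apply, EuclideanSpace.real_norm_sq_eq]
  rw [← (finCongr hn.symm).sum_comp]
  simp [hpos, r, LinearEquiv.funCongrLeft, pow_two]

theorem setIntegral_preimage_add_right {E : Type*} [NormedAddCommGroup E]
    [NormedSpace ℝ E] [MeasurableSpace E] [BorelSpace E] [FiniteDimensional ℝ E] (μ : Measure E)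
    [μ.IsAddHaarMeasure] {K : Set E} (hK : IsCompact K) (c : E) :
    ∫ x in (fun x => x + c) ⁻¹' K, x ∂μ = (∫ x in K, x ∂μ) - μ.real K • c := by
  have h := (measurePreserving_add_right μ c).setIntegral_preimage_emb
    (measurableEmbedding_addRight c) (fun y => y - c) K
  simp only [add_sub_cancel_right] at h
  have hi : IntegrableOn (fun y : E => y) K μ := continuous_id.continuousOn.integrableOn_compact hK
  rw [h, integral_sub (f := fun y : E => y) (g := fun _ => c) hi
    (integrableOn_const hK.measure_lt_top.ne), setIntegral_const]

theorem setIntegral_eq_zero_of_neg_eq {E : Type*} [NormedAddCommGroup E] [NormedSpace ℝ E]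
    [MeasurableSpace E] [BorelSpace E] [FiniteDimensional ℝ E] (μ : Measure E)
    [μ.IsAddHaarMeasure] {L : Set E} (hL : -L = L) : ∫ x in L, x ∂μ = 0 := by
  have h := (Measure.measurePreserving_neg μ).setIntegral_preimage_emb
    (MeasurableEquiv.neg E).measurableEmbedding (fun y => y) L
  rw [neg_preimage, hL, integral_neg] at h
  have h2 : (2 : ℝ) • ∫ x in L, x ∂μ = 0 := by
    rw [two_smul]
    nth_rewrite 1 [← h]
    exact neg_add_cancel _
  exact (smul_eq_zero.1 h2).resolve_left two_ne_zero

section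

variable {n : ℕ} {L : Set (EuclideanSpace ℝ (Fin n))}

theorem gaugeDensity_closedBall (x : EuclideanSpace ℝ (Fin n)) :
    gaugeDensity (Metric.closedBall 0 1) x = exp (-(1 / 2) * ‖x‖ ^ 2) := by
  rw [gaugeDensity, gauge_closedBall zero_le_one, div_one]
  ring_nf

/-- The radial normalization satisfies `J² ω_n² = (2π)ⁿ`. -/
theorem sq_integral_mul_volume_ball (n : ℕ) :
    ((∫ r in Ioi (0 : ℝ), r * exp (-(r ^ 2 / 2)) *
        (r ^ Module.finrank ℝ (EuclideanSpace ℝ (Fin n)) * r ^ 0)) *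
      volume.real (Metric.ball (0 : EuclideanSpace ℝ (Fin n)) 1)) ^ 2 = (2 * π) ^ n := by
  have h1 := integral_gaugeDensity (μ := volume) (convex_closedBall 0 1)
    (isCompact_closedBall (0 : EuclideanSpace ℝ (Fin n)) 1) (Metric.closedBall_mem_nhds 0 one_pos)
  simp_rw [gaugeDensity_closedBall] at h1
  rw [GaussianFourier.integral_rexp_neg_mul_sq_norm (by norm_num)] at h1
  have h2 : volume.real (Metric.ball (0 : EuclideanSpace ℝ (Fin n)) 1) =
      volume.real (Metric.closedBall (0 : EuclideanSpace ℝ (Fin n)) 1) := by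
    rw [Measure.real, Measure.real, Measure.addHaar_unitClosedBall_eq_addHaar_unitBall]
  rw [h2, ← h1, ← rpow_natCast, ← rpow_mul (by positivity), finrank_euclideanSpace_fin]
  rw [show (n : ℝ) / 2 * ((2 : ℕ) : ℝ) = n by push_cast; ring, rpow_natCast]
  congr 1
  field_simp

theorem volume_mul_volume_polarBody_le (hL : Convex ℝ L) (hLc : IsCompact L) (hL0 : L ∈ 𝓝 0)
    (hbar : ∫ x in L, x = 0) :
    volume.real L * volume.real (polarBody L) ≤
      volume.real (Metric.ball (0 : EuclideanSpace ℝ (Fin n)) 1) ^ 2 ∧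
    (volume.real L * volume.real (polarBody L) =
      volume.real (Metric.ball (0 : EuclideanSpace ℝ (Fin n)) 1) ^ 2 →
      ∃ A : EuclideanSpace ℝ (Fin n) ≃ₗ[ℝ] EuclideanSpace ℝ (Fin n),
        L = A '' Metric.closedBall 0 1) := by
  have hP := convex_polarBody L
  have hPc := isCompact_polarBody hL0
  have hP0 := polarBody_mem_nhds hLc.isBounded
  have hf := rapidDecay_gaugeDensity hL hLc hL0
  have hg := rapidDecay_gaugeDensity hP hPc hP0
  have hfg := gaugeDensity_mul_gaugeDensity_polarBody_le hL hLc hL0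
  obtain ⟨hle, heq⟩ := santaloProperty_euclideanSpace n _ _ hf hg
    (integral_gaugeDensity_smul_id hL hLc hL0 hbar) hfg
  have hJ := sq_integral_mul_volume_ball n
  have e1 := integral_gaugeDensity (μ := volume) hL hLc hL0
  have e2 := integral_gaugeDensity (μ := volume) hP hPc hP0
  set J := ∫ r in Ioi (0 : ℝ), r * exp (-(r ^ 2 / 2)) *
        (r ^ Module.finrank ℝ (EuclideanSpace ℝ (Fin n)) * r ^ 0)
  have hJ0 : 0 < J ^ 2 := by
    refine pow_pos ?_ 2
    have h := hf.integral_pos (volume)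
    rw [e1] at h
    exact pos_of_mul_pos_left h measureReal_nonneg
  have hprod : (∫ x, gaugeDensity L x) * ∫ x, gaugeDensity (polarBody L) x =
      J ^ 2 * (volume.real L * volume.real (polarBody L)) := by
    rw [e1, e2]; ring
  rw [hprod, ← hJ, mul_pow] at hle
  refine ⟨le_of_mul_le_mul_left hle hJ0, fun h => ?_⟩
  have htot : (∫ x, gaugeDensity L x) * ∫ x, gaugeDensity (polarBody L) x = (2 * π) ^ n := by
    rw [hprod, h, ← hJ, mul_pow]
  obtain ⟨hgauss, -⟩ := heq htot
  obtain ⟨-, heq'⟩ := santaloProperty_euclideanSpace n _ _ hg hf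
    hgauss.integral_smul_id_eq_zero (fun x y => by
      have := hfg y x
      rwa [mul_comm, real_inner_comm] at this)
  obtain ⟨⟨Q, hQ⟩, -⟩ := heq' (by rw [mul_comm]; exact htot)
  have hQg : ∀ x, Q x = gauge L x ^ 2 := fun x => by
    have := hQ x
    simp only [gaugeDensity, gauge_zero, ne_eq, OfNat.ofNat_ne_zero, not_false_eq_true, zero_pow,
      zero_div, neg_zero, exp_zero, one_mul] at this
    have := exp_injective this
    linarith
  obtain ⟨R, hR0, hR⟩ := exists_norm_le_mul_gauge hLc hL0
  obtain ⟨A, hA⟩ := QuadraticForm.exists_linearEquiv_eq_norm_sq (Q := Q) fun x hx => by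
    rw [hQg]
    have h1 := (norm_pos_iff.2 hx).trans_le (hR x)
    exact pow_pos ((mul_pos_iff_of_pos_left hR0).1 h1) 2
  refine ⟨A.symm, ?_⟩
  rw [LinearEquiv.image_symm_eq_preimage]
  ext x
  rw [← setOf_gauge_le_one hL hLc hL0, mem_ofPred_eq, mem_preimage, mem_closedBall_zero_iff]
  have h1 : gauge L x ^ 2 = ‖A x‖ ^ 2 := by rw [← hQg, hA]
  rw [(sq_eq_sq₀ (gauge_nonneg x) (norm_nonneg _)).1 h1]

theorem volume_mul_volume_polarBody_image_closedBall
    (A : EuclideanSpace ℝ (Fin n) ≃ₗ[ℝ] EuclideanSpace ℝ (Fin n)) :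
    volume.real (A '' Metric.closedBall 0 1) *
        volume.real (polarBody (A '' Metric.closedBall 0 1)) =
      volume.real (Metric.ball (0 : EuclideanSpace ℝ (Fin n)) 1) ^ 2 := by
  set f : EuclideanSpace ℝ (Fin n) →ₗ[ℝ] EuclideanSpace ℝ (Fin n) := A.toLinearMap
  have hpol : polarBody (A '' Metric.closedBall 0 1) =
      LinearMap.adjoint f ⁻¹' Metric.closedBall 0 1 := by
    ext y
    simp only [polarBody, mem_ofPred_eq, forall_mem_image, mem_preimage, mem_closedBall_zero_iff]
    have hadj : ∀ u, ⟪y, A u⟫ = ⟪LinearMap.adjoint f y, u⟫ := fun u =>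
      (LinearMap.adjoint_inner_left f u y).symm
    simp_rw [hadj]
    set w := LinearMap.adjoint f y
    constructor
    · intro h
      rcases eq_or_ne w 0 with hw | hw
      · simp [hw]
      have := h (x := ‖w‖⁻¹ • w) (by rw [norm_smul, norm_inv, norm_norm,
        inv_mul_cancel₀ (norm_ne_zero_iff.2 hw)])
      rwa [real_inner_smul_right, real_inner_self_eq_norm_sq, pow_two,
        inv_mul_cancel_left₀ (norm_ne_zero_iff.2 hw)] at this
    · intro h u hu
      exact (real_inner_le_norm w u).trans (mul_le_one₀ h (norm_nonneg u) hu)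
  have hdet : LinearMap.det (LinearMap.adjoint f) = LinearMap.det f := by
    let b := EuclideanSpace.basisFun (Fin n) ℝ
    rw [← LinearMap.det_toMatrix b.toBasis, ← LinearMap.det_toMatrix b.toBasis,
      LinearMap.toMatrix_adjoint, Matrix.det_conjTranspose, star_trivial]
  have hf0 : LinearMap.det f ≠ 0 := A.isUnit_det'.ne_zero
  have h2 : volume.real (Metric.closedBall (0 : EuclideanSpace ℝ (Fin n)) 1) =
      volume.real (Metric.ball (0 : EuclideanSpace ℝ (Fin n)) 1) := by
    rw [Measure.real, Measure.real, Measure.addHaar_unitClosedBall_eq_addHaar_unitBall]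
  rw [hpol]
  change volume.real (f '' _) * _ = _
  rw [Measure.real, Measure.real, Measure.addHaar_image_linearMap,
    Measure.addHaar_preimage_linearMap _ (by rwa [hdet]), hdet, ENNReal.toReal_mul,
    ENNReal.toReal_mul, ENNReal.toReal_ofReal (abs_nonneg _), ENNReal.toReal_ofReal (abs_nonneg _),
    ← Measure.real, h2, abs_inv]
  have := abs_pos.2 hf0
  field_simp

end

/-- The Blaschke–Santaló inequality with the Santaló point replaced by the center of
mass `c` of `K`: `vol(K) vol((K-c)°) ≤ ω_n²`, with equality iff `K` is an ellipsoid
(an invertible affine image of the Euclidean unit ball). -/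
theorem BS_center_of_mass (n : ℕ) (hn : 2 ≤ n)
    (K : Set (EuclideanSpace ℝ (Fin n))) (hK_conv : Convex ℝ K)
    (hK_cpt : IsCompact K) (hK_int : (interior K).Nonempty)
    (c : EuclideanSpace ℝ (Fin n)) (hc : c = (volume K).toReal⁻¹ • ∫ x in K, x) :
    (volume K).toReal *
        (volume {y : EuclideanSpace ℝ (Fin n) | ∀ z ∈ K, ⟪y, z - c⟫ ≤ 1}).toReal ≤
      (volume (Metric.ball (0 : EuclideanSpace ℝ (Fin n)) 1)).toReal ^ (2 : ℕ) ∧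
    ((volume K).toReal *
        (volume {y : EuclideanSpace ℝ (Fin n) | ∀ z ∈ K, ⟪y, z - c⟫ ≤ 1}).toReal =
      (volume (Metric.ball (0 : EuclideanSpace ℝ (Fin n)) 1)).toReal ^ (2 : ℕ) ↔
      ∃ φ : EuclideanSpace ℝ (Fin n) ≃ᵃ[ℝ] EuclideanSpace ℝ (Fin n),
        K = φ '' Metric.closedBall (0 : EuclideanSpace ℝ (Fin n)) 1) := by
  have hpre : ∀ d : EuclideanSpace ℝ (Fin n), (fun x => x + d) ⁻¹' K = (fun x => x - d) '' K :=
    fun d => by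
      ext x
      exact ⟨fun h => ⟨x + d, h, add_sub_cancel_right x d⟩,
        fun ⟨y, hy, h⟩ => by rw [mem_preimage, ← h, sub_add_cancel]; exact hy⟩
  have hpol : {y : EuclideanSpace ℝ (Fin n) | ∀ z ∈ K, ⟪y, z - c⟫ ≤ 1} =
      polarBody ((fun x => x + c) ⁻¹' K) := by
    ext y
    rw [hpre]
    simp [polarBody]
  have hvol : (volume K).toReal = volume.real ((fun x => x + c) ⁻¹' K) := by
    rw [Measure.real, measure_preimage_add_right]
  have hVpos : 0 < volume.real K := ENNReal.toReal_pos
    ((isOpen_interior.measure_pos volume hK_int).trans_le (measure_mono interior_subset)).ne'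
    hK_cpt.measure_lt_top.ne
  have hcint : c ∈ interior K := by
    have := hK_conv.setAverage_mem_interior (μ := volume) hK_cpt hK_int
    rwa [setAverage_eq, Measure.real, ← hc] at this
  have hbar : ∫ x in (fun x => x + c) ⁻¹' K, x = 0 := by
    rw [setIntegral_preimage_add_right volume hK_cpt, hc, ← Measure.real,
      smul_inv_smul₀ hVpos.ne', sub_self]
  have hL0 : (fun x => x + c) ⁻¹' K ∈ 𝓝 0 := by
    refine (continuous_add_const c).continuousAt.preimage_mem_nhds ?_
    rw [zero_add]
    exact mem_interior_iff_mem_nhds.1 hcint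
  have hLc : IsCompact ((fun x => x + c) ⁻¹' K) := by
    rw [hpre]
    exact hK_cpt.image (continuous_id.sub continuous_const)
  obtain ⟨hle, heq⟩ := volume_mul_volume_polarBody_le (hK_conv.translate_preimage_left c) hLc hL0
    hbar
  rw [hpol, hvol]
  refine ⟨hle, fun h => ?_, ?_⟩
  · obtain ⟨A, hA⟩ := heq h
    refine ⟨A.toAffineEquiv.trans (AffineEquiv.constVAdd ℝ _ c), ?_⟩
    rw [AffineEquiv.coe_trans, image_comp]
    change K = _ '' (A '' _)
    rw [← hA]
    ext x
    rw [hpre, image_image]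
    simp
  · rintro ⟨φ, hφ⟩
    have hφx : ∀ x, φ x = φ.linear x + φ 0 := fun x => by
      simpa using φ.map_vadd 0 x
    have hL : (fun x => x + φ 0) ⁻¹' K = φ.linear '' Metric.closedBall 0 1 := by
      rw [hpre, hφ, image_image]
      exact image_congr fun x _ => by rw [hφx x, add_sub_cancel_right]
    have hcφ : c = φ 0 := by
      have h1 := setIntegral_preimage_add_right volume hK_cpt (φ 0)
      rw [hL, setIntegral_eq_zero_of_neg_eq volume (by
        ext x
        simp only [Set.mem_neg, mem_image, mem_closedBall_zero_iff]
        constructor <;> rintro ⟨y, hy, h⟩ <;> exact ⟨-y, by simpa using hy, by simp [h]⟩)] at h1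
      rw [hc, eq_of_sub_eq_zero h1.symm, ← Measure.real, inv_smul_smul₀ hVpos.ne']
    rw [hcφ, hL]
    exact volume_mul_volume_polarBody_image_closedBall φ.linear
end

section
/- Let n ≥ 2, p ≥ 1, λ ∈ (1, ∞) with λ' = λ/(λ−1), and let K ⊂ ℝⁿ be a convex body with the origin in its interior, with gauge function g(K,x) = inf{ t > 0 : x ∈ tK }. A nonzero nonnegative continuous function f : ℝⁿ → ℝ with compact support satisfies equality in the moment inequality ‖f‖₁^{n + pλ'} ≤ a_{n,p,λ} ( ∫_{ℝⁿ} f(x) g(K,x)^p dx )^{n} ‖f‖_λ^{pλ'} vol(K)^{p} if and only if there exist constants a, b > 0 such that f(x) = a (1 − (b·g(K,x))^p)₊^{1/(λ−1)} for all x ∈ ℝⁿ, where t₊ = max{t,0}. -/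
open MeasureTheory Real
open scoped RealInnerProductSpace

/-- The constant `a_{n,p,λ}` for `λ > 1`, with `λ' = λ/(λ-1)`; here
`B(m,l) = Γ(m)Γ(l)/Γ(m+l)` is the Beta function. -/
noncomputable def anpl (n : ℕ) (p lam : ℝ) : ℝ :=
  (((n : ℝ) / p) * ((n : ℝ) / ((lam / (lam - 1)) * p) + 1) ^ (lam / (lam - 1) - 1) *
      ((lam / (lam - 1)) * p / (n : ℝ) + 1) ^ ((n : ℝ) / p) *
      (Real.Gamma ((n : ℝ) / p) * Real.Gamma (lam / (lam - 1)) /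
        Real.Gamma ((n : ℝ) / p + lam / (lam - 1)))) ^ p

section GaugeIntegration

variable {E : Type*} [NormedAddCommGroup E] [NormedSpace ℝ E]

theorem gauge_le_one_iff_mem {K : Set E} (hc : Convex ℝ K) (hK : IsCompact K)
    (h0 : (0 : E) ∈ interior K) {x : E} : gauge K x ≤ 1 ↔ x ∈ K := by
  rw [gauge_le_one_iff_mem_closure hc (mem_interior_iff_mem_nhds.1 h0), hK.isClosed.closure_eq]

variable [FiniteDimensional ℝ E] [MeasurableSpace E] [BorelSpace E]
  (μ : Measure E) [μ.IsAddHaarMeasure]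

open scoped Pointwise in
theorem measure_gauge_le [Nontrivial E] {K : Set E} (hc : Convex ℝ K) (hK : IsCompact K)
    (h0 : (0 : E) ∈ interior K) {t : ℝ} (ht : 0 ≤ t) :
    μ {x | gauge K x ≤ t} = ENNReal.ofReal (t ^ Module.finrank ℝ E) * μ K := by
  have hnhds := mem_interior_iff_mem_nhds.1 h0
  rcases ht.eq_or_lt with rfl | ht
  · have : {x : E | gauge K x ≤ 0} = {0} := by
      ext x
      have := gauge_pos (x := x) (absorbent_nhds_zero (𝕜 := ℝ) hnhds)
        ((NormedSpace.isVonNBounded_iff ℝ).2 hK.isBounded)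
      simp only [Set.mem_ofPred_eq, Set.mem_singleton_iff]
      rw [← not_lt, this, not_not]
    rw [this, measure_singleton, zero_pow Module.finrank_pos.ne']
    simp
  · have : {x : E | gauge K x ≤ t} = t • K := by
      ext x
      rw [Set.mem_smul_set_iff_inv_smul_mem₀ ht.ne', ← gauge_le_one_iff_mem hc hK h0,
        gauge_smul_of_nonneg (inv_nonneg.2 ht.le), smul_eq_mul, inv_mul_le_one₀ ht]
      rfl
    rw [this, Measure.addHaar_smul_of_nonneg μ ht.le]

theorem measure_smul_map_gauge [Nontrivial E] {K L : Set E} (hKc : Convex ℝ K) (hK : IsCompact K)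
    (hK0 : (0 : E) ∈ interior K) (hLc : Convex ℝ L) (hL : IsCompact L)
    (hL0 : (0 : E) ∈ interior L) :
    μ L • μ.map (gauge K) = μ K • μ.map (gauge L) := by
  have key : ∀ {K L : Set E}, Convex ℝ K → IsCompact K → (0 : E) ∈ interior K →
      IsCompact L → ∀ a b, a < b → (μ L • μ.map (gauge K)) (Set.Ioc a b) =
        (ENNReal.ofReal ((max b 0) ^ Module.finrank ℝ E) -
          ENNReal.ofReal ((max a 0) ^ Module.finrank ℝ E)) * (μ K * μ L) := by
    intro K L hKc hK hK0 hL a b hab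
    have hm : Measurable (gauge K) :=
      (continuous_gauge hKc (mem_interior_iff_mem_nhds.1 hK0)).measurable
    rw [Measure.smul_apply, Measure.map_apply hm measurableSet_Ioc]
    by_cases hb : b < 0
    · have : gauge K ⁻¹' Set.Ioc a b = ∅ := by
        ext x
        have := gauge_nonneg (s := K) x
        simp only [Set.mem_preimage, Set.mem_Ioc, Set.mem_empty_iff_false, iff_false]
        rintro ⟨-, h⟩
        linarith
      rw [this, max_eq_right hb.le, max_eq_right (hab.trans hb).le]
      simp
    push Not at hb
    have hle : ∀ t, μ (gauge K ⁻¹' Set.Iic t) ≤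
        ENNReal.ofReal ((max t 0) ^ Module.finrank ℝ E) * μ K := by
      intro t
      rw [← measure_gauge_le μ hKc hK hK0 (le_max_right t 0)]
      exact measure_mono fun x (hx : gauge K x ≤ t) => le_max_of_le_left hx
    have hEq : ∀ t, μ (gauge K ⁻¹' Set.Iic t) =
        ENNReal.ofReal ((max t 0) ^ Module.finrank ℝ E) * μ K := by
      intro t
      rcases le_total 0 t with ht | ht
      · rw [max_eq_left ht, ← measure_gauge_le μ hKc hK hK0 ht]
        rfl
      · refine le_antisymm (hle t) ?_
        rw [max_eq_right ht, zero_pow Module.finrank_pos.ne']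
        simp
    have hfin : ∀ t, μ (gauge K ⁻¹' Set.Iic t) ≠ ⊤ := fun t => by
      rw [hEq]
      exact ENNReal.mul_ne_top ENNReal.ofReal_ne_top hK.measure_lt_top.ne
    rw [← Set.Iic_sdiff_Iic, Set.preimage_sdiff,
      measure_sdiff (Set.preimage_mono (Set.Iic_subset_Iic.2 hab.le))
        (hm measurableSet_Iic).nullMeasurableSet (hfin a), hEq, hEq,
      ← ENNReal.sub_mul fun _ _ => hK.measure_lt_top.ne, smul_eq_mul]
    ring
  refine Measure.ext_of_Ioc' _ _ (fun a b hab => ?_) fun a b hab => ?_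
  · rw [key hKc hK hK0 hL a b hab]
    exact ENNReal.mul_ne_top (ENNReal.sub_ne_top ENNReal.ofReal_ne_top)
      (ENNReal.mul_ne_top hK.measure_lt_top.ne hL.measure_lt_top.ne)
  · rw [key hKc hK hK0 hL a b hab, key hLc hL hL0 hK a b hab, mul_comm (μ K)]

theorem integral_comp_gauge [Nontrivial E] {K : Set E} (hc : Convex ℝ K) (hK : IsCompact K)
    (h0 : (0 : E) ∈ interior K) {φ : ℝ → ℝ} (hφ : Measurable φ) :
    ∫ x, φ (gauge K x) ∂μ = Module.finrank ℝ E * μ.real K *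
      ∫ t in Set.Ioi (0 : ℝ), t ^ (Module.finrank ℝ E - 1) * φ t := by
  set L : Set E := Metric.closedBall 0 1
  have hL : IsCompact L := isCompact_closedBall 0 1
  have hLc : Convex ℝ L := convex_closedBall 0 1
  have hL0 : (0 : E) ∈ interior L := by
    rw [mem_interior_iff_mem_nhds]
    exact Metric.closedBall_mem_nhds 0 one_pos
  have hmeas : ∀ {K : Set E}, Convex ℝ K → (0 : E) ∈ interior K →
      Measurable (gauge K) := fun hc h0 =>
    (continuous_gauge hc (mem_interior_iff_mem_nhds.1 h0)).measurable
  have h := congrArg (fun ν => ∫ t, φ t ∂ν) (measure_smul_map_gauge μ hc hK h0 hLc hL hL0)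
  simp only [integral_smul_measure] at h
  rw [integral_map (hmeas hc h0).aemeasurable hφ.aestronglyMeasurable,
    integral_map (hmeas hLc hL0).aemeasurable hφ.aestronglyMeasurable] at h
  have hn : ∀ x : E, gauge L x = ‖x‖ := fun x => by
    rw [gauge_closedBall zero_le_one, div_one]
  simp only [hn] at h
  rw [integral_fun_norm_addHaar, ← measureReal_def, ← measureReal_def] at h
  have hball : μ.real (Metric.ball 0 1) = μ.real L :=
    (Measure.addHaar_real_closedBall_eq_addHaar_real_ball μ 0 1).symm
  have hpos : 0 < μ.real L :=
    ENNReal.toReal_pos (Measure.measure_pos_of_mem_nhds μ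
      (mem_interior_iff_mem_nhds.1 hL0)).ne' hL.measure_lt_top.ne
  rw [hball] at h
  simp only [smul_eq_mul, nsmul_eq_mul] at h
  refine mul_left_cancel₀ hpos.ne' (h.trans ?_)
  ring

theorem integral_comp_gauge_rpow [Nontrivial E] {K : Set E} (hc : Convex ℝ K) (hK : IsCompact K)
    (h0 : (0 : E) ∈ interior K) {p : ℝ} (hp : 0 < p) {φ : ℝ → ℝ} (hφ : Measurable φ) :
    ∫ x, φ (gauge K x ^ p) ∂μ = Module.finrank ℝ E / p * μ.real K *
      ∫ u in Set.Ioi (0 : ℝ), u ^ (Module.finrank ℝ E / p - 1) * φ u := by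
  rw [integral_comp_gauge μ hc hK h0 (φ := fun t => φ (t ^ p)) (by fun_prop),
    ← integral_comp_rpow_Ioi_of_pos (g := fun u => u ^ (Module.finrank ℝ E / p - 1) * φ u) hp]
  have : ∀ t ∈ Set.Ioi (0 : ℝ), (p * t ^ (p - 1)) • ((t ^ p) ^ (Module.finrank ℝ E / p - 1) *
      φ (t ^ p)) = p * (t ^ (Module.finrank ℝ E - 1) * φ (t ^ p)) := by
    intro t ht
    have ht : 0 < t := ht
    have h1 : t ^ (p - 1) * (t ^ p) ^ (Module.finrank ℝ E / p - 1) =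
        t ^ (Module.finrank ℝ E - 1) := by
      rw [← rpow_mul ht.le, ← rpow_add ht, ← rpow_natCast,
        Nat.cast_sub (Nat.one_le_iff_ne_zero.2 Module.finrank_pos.ne')]
      congr 1
      field_simp
      push_cast
      ring
    rw [← h1, smul_eq_mul]
    ring
  rw [setIntegral_congr_fun measurableSet_Ioi this, integral_const_mul]
  field_simp

end GaugeIntegration

theorem integral_rpow_mul_max_one_sub_rpow {x y : ℝ} (hx : 0 < x) (hy : 0 < y) :
    ∫ u in Set.Ioi (0 : ℝ), u ^ (x - 1) * (max (1 - u) 0) ^ y =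
      ProbabilityTheory.beta x (y + 1) := by
  have h1 : ∫ u in Set.Ioi (0 : ℝ), u ^ (x - 1) * (max (1 - u) 0) ^ y =
      ∫ u in Set.Ioc (0 : ℝ) 1, u ^ (x - 1) * (1 - u) ^ y := by
    rw [← Set.Ioc_union_Ioi_eq_Ioi zero_le_one,
      setIntegral_eq_of_subset_of_forall_sdiff_eq_zero (s := Set.Ioc 0 1)
      (measurableSet_Ioc.union measurableSet_Ioi) Set.subset_union_left]
    · refine setIntegral_congr_fun measurableSet_Ioc fun u hu => ?_
      rw [max_eq_left (by linarith [hu.2])]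
    · rintro u ⟨hu | hu, hu'⟩
      · exact absurd hu hu'
      · have : (1 : ℝ) < u := hu
        rw [max_eq_right (by linarith), zero_rpow hy.ne', mul_zero]
  rw [h1, ProbabilityTheory.beta_eq_betaIntegralReal x (y + 1) hx (by linarith),
    Complex.betaIntegral, intervalIntegral.integral_of_le zero_le_one]
  have h2 : ∀ u ∈ Set.Ioc (0 : ℝ) 1, (u : ℂ) ^ ((x : ℂ) - 1) *
      (1 - (u : ℂ)) ^ (((y + 1 : ℝ) : ℂ) - 1) =
      ((u ^ (x - 1) * (1 - u) ^ y : ℝ) : ℂ) := by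
    intro u hu
    rw [Complex.ofReal_mul, Complex.ofReal_cpow hu.1.le, Complex.ofReal_cpow (by linarith [hu.2])]
    push_cast
    ring_nf
  rw [setIntegral_congr_fun measurableSet_Ioc h2, integral_complex_ofReal, Complex.ofReal_re]

theorem beta_add_one_left {x y : ℝ} (hx : 0 < x) (hy : 0 < y) :
    ProbabilityTheory.beta (x + 1) y = ProbabilityTheory.beta x y * (x / (x + y)) := by
  have h := (Real.Gamma_pos_of_pos (add_pos hx hy)).ne'
  rw [ProbabilityTheory.beta, ProbabilityTheory.beta, add_right_comm, Real.Gamma_add_one hx.ne',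
    Real.Gamma_add_one (add_pos hx hy).ne']
  field_simp

theorem beta_add_one_right {x y : ℝ} (hx : 0 < x) (hy : 0 < y) :
    ProbabilityTheory.beta x (y + 1) = ProbabilityTheory.beta x y * (y / (x + y)) := by
  have h := (Real.Gamma_pos_of_pos (add_pos hx hy)).ne'
  rw [ProbabilityTheory.beta, ProbabilityTheory.beta, ← add_assoc, Real.Gamma_add_one hy.ne',
    Real.Gamma_add_one (add_pos hx hy).ne']
  field_simp

section GaugeProfile

variable {E : Type*} [NormedAddCommGroup E] [NormedSpace ℝ E]

theorem continuous_gauge_profile {K : Set E} (hc : Convex ℝ K) (h0 : (0 : E) ∈ interior K)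
    {p b σ : ℝ} (hp : 0 < p) (hσ : 0 < σ) :
    Continuous fun x => (max (1 - (b * gauge K x) ^ p) 0) ^ σ := by
  have hg := continuous_gauge hc (mem_interior_iff_mem_nhds.1 h0)
  exact ((continuous_const.sub ((continuous_const.mul hg).rpow_const fun _ => .inr hp.le)).max
    continuous_const).rpow_const fun _ => .inr hσ.le

theorem hasCompactSupport_gauge_profile {K : Set E} (hc : Convex ℝ K) (hK : IsCompact K)
    (h0 : (0 : E) ∈ interior K) {p b σ : ℝ} (hp : 0 < p) (hb : 0 < b) (hσ : 0 < σ) :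
    HasCompactSupport fun x => (max (1 - (b * gauge K x) ^ p) 0) ^ σ := by
  refine HasCompactSupport.intro (hK.image (continuous_const_smul b⁻¹)) fun x hx => ?_
  have h : 1 < b * gauge K x := by
    by_contra! hle
    refine hx ⟨b • x, ?_, inv_smul_smul₀ hb.ne' x⟩
    rwa [← gauge_le_one_iff_mem hc hK h0, gauge_smul_of_nonneg hb.le]
  have := one_le_rpow h.le hp.le
  rw [max_eq_right (by linarith), zero_rpow hσ.ne']

variable [FiniteDimensional ℝ E] [MeasurableSpace E] [BorelSpace E]
  (μ : Measure E) [μ.IsAddHaarMeasure] [Nontrivial E]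

theorem integral_comp_mul_gauge_rpow {K : Set E} (hc : Convex ℝ K) (hK : IsCompact K)
    (h0 : (0 : E) ∈ interior K) {p b : ℝ} (hp : 0 < p) (hb : 0 < b) {φ : ℝ → ℝ}
    (hφ : Measurable φ) :
    ∫ x, φ ((b * gauge K x) ^ p) ∂μ = (b ^ Module.finrank ℝ E)⁻¹ *
      (Module.finrank ℝ E / p * μ.real K *
        ∫ u in Set.Ioi (0 : ℝ), u ^ (Module.finrank ℝ E / p - 1) * φ u) := by
  rw [← integral_comp_gauge_rpow μ hc hK h0 hp hφ, ← smul_eq_mul (b ^ Module.finrank ℝ E)⁻¹,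
    ← Measure.integral_comp_smul_of_nonneg μ (fun x => φ (gauge K x ^ p)) b (hR := hb.le)]
  simp only [gauge_smul_of_nonneg hb.le, smul_eq_mul]

theorem integral_gauge_profile {K : Set E} (hc : Convex ℝ K) (hK : IsCompact K)
    (h0 : (0 : E) ∈ interior K) {p b σ : ℝ} (hp : 0 < p) (hb : 0 < b) (hσ : 0 < σ) :
    ∫ x, (max (1 - (b * gauge K x) ^ p) 0) ^ σ ∂μ = (b ^ Module.finrank ℝ E)⁻¹ *
      (Module.finrank ℝ E / p * μ.real K *
        ProbabilityTheory.beta (Module.finrank ℝ E / p) (σ + 1)) := by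
  have hn : (0 : ℝ) < Module.finrank ℝ E := Nat.cast_pos.2 Module.finrank_pos
  rw [integral_comp_mul_gauge_rpow μ hc hK h0 hp hb (φ := fun u => (max (1 - u) 0) ^ σ)
    (by fun_prop), integral_rpow_mul_max_one_sub_rpow (by positivity) hσ]

theorem integral_gauge_profile_mul_gauge_rpow {K : Set E} (hc : Convex ℝ K) (hK : IsCompact K)
    (h0 : (0 : E) ∈ interior K) {p b σ : ℝ} (hp : 0 < p) (hb : 0 < b) (hσ : 0 < σ) :
    ∫ x, (max (1 - (b * gauge K x) ^ p) 0) ^ σ * gauge K x ^ p ∂μ =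
      (b ^ Module.finrank ℝ E)⁻¹ * (b ^ p)⁻¹ * (Module.finrank ℝ E / p * μ.real K *
        ProbabilityTheory.beta (Module.finrank ℝ E / p + 1) (σ + 1)) := by
  have hn : (0 : ℝ) < Module.finrank ℝ E := Nat.cast_pos.2 Module.finrank_pos
  have hbp : 0 < b ^ p := rpow_pos_of_pos hb p
  have h1 : ∀ x : E, (max (1 - (b * gauge K x) ^ p) 0) ^ σ * gauge K x ^ p =
      (b ^ p)⁻¹ * ((max (1 - (b * gauge K x) ^ p) 0) ^ σ * (b * gauge K x) ^ p) := fun x => by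
    rw [mul_rpow (x := b) (y := gauge K x) hb.le (gauge_nonneg x)]
    field_simp
  have h2 : ∀ u ∈ Set.Ioi (0 : ℝ), u ^ ((Module.finrank ℝ E : ℝ) / p - 1) *
      ((max (1 - u) 0) ^ σ * u) =
      u ^ ((Module.finrank ℝ E : ℝ) / p + 1 - 1) * (max (1 - u) 0) ^ σ := fun u hu => by
    rw [add_sub_right_comm, rpow_add_one (ne_of_gt hu)]
    ring
  simp only [h1]
  rw [integral_const_mul, integral_comp_mul_gauge_rpow μ hc hK h0 hp hb
    (φ := fun u => (max (1 - u) 0) ^ σ * u) (by fun_prop),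
    setIntegral_congr_fun measurableSet_Ioi h2,
    integral_rpow_mul_max_one_sub_rpow (by positivity) hσ]
  ring

end GaugeProfile

theorem mul_mul_rpow_sub_one_lt {x y r : ℝ} (hx : 0 ≤ x) (hy : 0 ≤ y) (hr : 1 < r) (hxy : x ≠ y) :
    r * (x * y ^ (r - 1)) < x ^ r + (r - 1) * y ^ r := by
  rcases hy.eq_or_lt with rfl | hy
  · have : 0 < x ^ r := rpow_pos_of_pos (lt_of_le_of_ne hx hxy.symm) r
    rw [zero_rpow (by linarith), zero_rpow (by linarith)]
    simpa using this
  · have h := one_add_mul_self_lt_rpow_one_add (s := x / y - 1)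
      (by linarith [div_nonneg hx hy.le])
      (fun h => hxy ((div_eq_one_iff_eq hy.ne').1 (sub_eq_zero.1 h))) hr
    rw [add_sub_cancel, div_rpow hx hy.le, lt_div_iff₀ (rpow_pos_of_pos hy r)] at h
    have e : y ^ r = y ^ (r - 1) * y := by
      rw [← rpow_add_one hy.ne', sub_add_cancel]
    have e2 : (1 + r * (x / y - 1)) * y ^ r = r * (x * y ^ (r - 1)) - (r - 1) * y ^ r := by
      rw [e]
      field_simp
      ring
    linarith

theorem mul_mul_rpow_sub_one_le {x y r : ℝ} (hx : 0 ≤ x) (hy : 0 ≤ y) (hr : 1 < r) :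
    r * (x * y ^ (r - 1)) ≤ x ^ r + (r - 1) * y ^ r := by
  rcases eq_or_ne x y with rfl | h
  · rcases hx.eq_or_lt with rfl | hx
    · rw [zero_rpow (by linarith), zero_rpow (by linarith)]
      simp
    · rw [mul_comm x, ← rpow_add_one hx.ne', sub_add_cancel]
      linarith
  · exact (mul_mul_rpow_sub_one_lt hx hy hr h).le

theorem hasCompactSupport_rpow {X : Type*} [TopologicalSpace X] {f : X → ℝ}
    (hf : HasCompactSupport f) {r : ℝ} (hr : 0 < r) : HasCompactSupport fun x => f x ^ r :=
  hf.comp_left (g := fun t : ℝ => t ^ r) (zero_rpow hr.ne')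

theorem eq_of_integral_mul_eq_integral_rpow {X : Type*} [TopologicalSpace X] [MeasurableSpace X]
    [OpensMeasurableSpace X] {μ : Measure X} [IsFiniteMeasureOnCompacts μ] [μ.IsOpenPosMeasure]
    {f h w : X → ℝ} {r : ℝ} (hr : 1 < r) (hf : Continuous f) (hfs : HasCompactSupport f)
    (hf0 : ∀ x, 0 ≤ f x) (hh : Continuous h) (hhs : HasCompactSupport h) (hh0 : ∀ x, 0 ≤ h x)
    (hw : Continuous w) (hwh : ∀ x, w x ≤ h x ^ (r - 1))
    (hfh : ∫ x, f x ^ r ∂μ = ∫ x, h x ^ r ∂μ) (hfw : ∫ x, f x * w x ∂μ = ∫ x, h x ^ r ∂μ) :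
    f = h := by
  have hr0 : 0 < r := by linarith
  have cf : Continuous fun x => f x ^ r := hf.rpow_const fun _ => .inr hr0.le
  have ch : Continuous fun x => h x ^ r := hh.rpow_const fun _ => .inr hr0.le
  have cw : Continuous fun x => f x * w x := hf.mul hw
  have sf := hasCompactSupport_rpow hfs hr0
  have sh := hasCompactSupport_rpow hhs hr0
  have sw : HasCompactSupport fun x => f x * w x := hfs.mul_right
  have hle : ∀ x, r * (f x * w x) ≤ r * (f x * h x ^ (r - 1)) := fun x =>
    mul_le_mul_of_nonneg_left (mul_le_mul_of_nonneg_left (hwh x) (hf0 x)) hr0.le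
  have hint : ∫ x, (f x ^ r + (r - 1) * h x ^ r - r * (f x * w x)) ∂μ = 0 := by
    have i1 := cf.integrable_of_hasCompactSupport (μ := μ) sf
    have i2 := (ch.integrable_of_hasCompactSupport (μ := μ) sh).const_mul (r - 1)
    have i3 := (cw.integrable_of_hasCompactSupport (μ := μ) sw).const_mul r
    rw [integral_sub (by exact i1.add i2) i3, integral_add i1 i2, integral_const_mul,
      integral_const_mul, hfh, hfw]
    ring
  by_contra hne
  obtain ⟨x, hx⟩ := Function.ne_iff.1 hne
  refine (Continuous.integral_pos_of_hasCompactSupport_nonneg_nonzero (μ := μ) (x := x)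
    (f := fun x => f x ^ r + (r - 1) * h x ^ r - r * (f x * w x))
    ((cf.add (continuous_const.mul ch)).sub (continuous_const.mul cw)) ?_ ?_ ?_).ne' hint
  · exact (sf.add (sh.mul_left (f := fun _ => r - 1))).sub (sw.mul_left (f := fun _ => r))
  · intro y
    have := mul_mul_rpow_sub_one_le (hf0 y) (hh0 y) hr
    have := hle y
    simp only [Pi.zero_apply]
    linarith
  · have := mul_mul_rpow_sub_one_lt (hf0 x) (hh0 x) hr hx
    have := hle x
    exact (by linarith : (0 : ℝ) < _).ne'

theorem profile_moment_identity {n : ℕ} {p l lam m a b V B : ℝ} (hn : 0 < m)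
    (hnm : (n : ℝ) = m * p) (hlam : 1 < lam) (hl : l = lam / (lam - 1)) (ha : 0 < a) (hb : 0 < b)
    (hV : 0 < V) (hB : 0 < B) :
    (a * ((b ^ n)⁻¹ * (m * V * B))) ^ ((n : ℝ) + p * l) =
      (m * (m / l + 1) ^ (l - 1) * (l / m + 1) ^ m * B) ^ p *
        (a * ((b ^ n)⁻¹ * (b ^ p)⁻¹ * (m * V * (B * (m / (m + l)))))) ^ (n : ℝ) *
        ((a ^ lam * ((b ^ n)⁻¹ * (m * V * (B * (l / (m + l)))))) ^ (1 / lam)) ^ (p * l) *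
        V ^ p := by
  have hl0 : 0 < l := hl ▸ div_pos (by linarith) (by linarith)
  have hlam0 : 0 < lam := by linarith
  have hlam1 : lam - 1 ≠ 0 := by linarith
  have hml : 0 < m + l := by linarith
  have e1 : m / l + 1 = (m + l) / l := by field_simp
  have e2 : l / m + 1 = (m + l) / m := by field_simp; ring
  have e3 : l / lam = l - 1 := by rw [hl]; field_simp; ring
  rw [e1, e2, ← rpow_natCast b n]
  apply Real.log_injOn_pos (Set.mem_Ioi.2 (by positivity)) (Set.mem_Ioi.2 (by positivity))
  simp (disch := positivity) only [Real.log_mul, Real.log_rpow, Real.log_inv, Real.log_div]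
  have e4 : ∀ z : ℝ, p * l * (1 / lam * z) = p * (l - 1) * z := fun z => by rw [← e3]; ring
  rw [e4, hnm]
  have e5 : lam * (l - 1) = l := by rw [← e3]; field_simp
  linear_combination (-p * log a) * e5

/-- Equality case of the Lutwak–Yang–Zhang moment inequality, `λ ∈ (1, ∞)`: equality
holds iff `f(x) = a (1 - (b g(K,x))^p)₊^{1/(λ-1)}` for some `a, b > 0`. -/
theorem LYZ_moment_inequality_equality_case (n : ℕ) (hn : 2 ≤ n) (p : ℝ) (hp : 1 ≤ p)
    (lam : ℝ) (hlam : 1 < lam)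
    (K : Set (EuclideanSpace ℝ (Fin n))) (hK_conv : Convex ℝ K)
    (hK_cpt : IsCompact K) (hK_zero : (0 : EuclideanSpace ℝ (Fin n)) ∈ interior K)
    (f : EuclideanSpace ℝ (Fin n) → ℝ) (hf_cont : Continuous f)
    (hf_nonneg : ∀ x, 0 ≤ f x) (hf_supp : HasCompactSupport f) (hf_ne : f ≠ 0) :
    (∫ x, f x) ^ ((n : ℝ) + p * (lam / (lam - 1))) =
      anpl n p lam * (∫ x, f x * gauge K x ^ p) ^ (n : ℝ) *
        ((∫ x, |f x| ^ lam) ^ (1 / lam)) ^ (p * (lam / (lam - 1))) *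
        (volume K).toReal ^ p ↔
      ∃ a b : ℝ, 0 < a ∧ 0 < b ∧
        ∀ x, f x = a * (max (1 - (b * gauge K x) ^ p) 0) ^ (1 / (lam - 1)) := by
  have : Nonempty (Fin n) := ⟨⟨0, by omega⟩⟩
  have hp0 : 0 < p := by linarith
  have hn0 : (0 : ℝ) < n := Nat.cast_pos.2 (by omega)
  have hlam1 : 0 < lam - 1 := by linarith
  have hlam0 : 0 < lam := by linarith
  obtain ⟨l, hl⟩ : ∃ l, l = lam / (lam - 1) := ⟨_, rfl⟩
  obtain ⟨s, hs⟩ : ∃ s, s = 1 / (lam - 1) := ⟨_, rfl⟩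
  obtain ⟨m, hm⟩ : ∃ m, m = (n : ℝ) / p := ⟨_, rfl⟩
  obtain ⟨V, hV⟩ : ∃ V, V = (volume K).toReal := ⟨_, rfl⟩
  have hl0 : 0 < l := hl ▸ div_pos hlam0 hlam1
  have hs0 : 0 < s := hs ▸ div_pos one_pos hlam1
  have hm0 : 0 < m := hm ▸ div_pos hn0 hp0
  have hsl : s + 1 = l := by rw [hs, hl]; field_simp; ring
  have hsl' : s * lam = l := by rw [hs, hl]; field_simp
  have hslam : s * (lam - 1) = 1 := by rw [hs]; field_simp
  have hV0 : 0 < V := hV ▸ ENNReal.toReal_pos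
    (Measure.measure_pos_of_mem_nhds volume (mem_interior_iff_mem_nhds.1 hK_zero)).ne'
    hK_cpt.measure_lt_top.ne
  set B := ProbabilityTheory.beta m l with hB
  have hB0 : 0 < B := ProbabilityTheory.beta_pos hm0 hl0
  have hanpl : anpl n p lam = (m * (m / l + 1) ^ (l - 1) * (l / m + 1) ^ m * B) ^ p := by
    have e1 : (n : ℝ) / (l * p) = m / l := by rw [hm]; field_simp
    have e2 : l * p / (n : ℝ) = l / m := by rw [hm]; field_simp
    rw [anpl, ← hl, e1, e2, ← hm, hB, ProbabilityTheory.beta]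
  simp only [abs_of_nonneg (hf_nonneg _), hanpl, ← hl, ← hs, ← hV]
  set u : ℝ → EuclideanSpace ℝ (Fin n) → ℝ := fun b x => (max (1 - (b * gauge K x) ^ p) 0) ^ s
    with hu
  have hu0 : ∀ b x, 0 ≤ u b x := fun b x => rpow_nonneg (le_max_right _ _) _
  have hF : ∀ a b, 0 < a → 0 < b → ∫ x, a * u b x = a * ((b ^ n)⁻¹ * (m * V * B)) := by
    intro a b _ hb
    rw [integral_const_mul, integral_gauge_profile volume hK_conv hK_cpt hK_zero hp0 hb hs0,
      finrank_euclideanSpace_fin, ← hm, measureReal_def, ← hV, hsl]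
  have hM : ∀ a b, 0 < a → 0 < b → ∫ x, a * u b x * gauge K x ^ p =
      a * ((b ^ n)⁻¹ * (b ^ p)⁻¹ * (m * V * (B * (m / (m + l))))) := by
    intro a b _ hb
    simp only [mul_assoc a]
    rw [integral_const_mul,
      integral_gauge_profile_mul_gauge_rpow volume hK_conv hK_cpt hK_zero hp0 hb hs0,
      finrank_euclideanSpace_fin, ← hm, measureReal_def, ← hV, hsl, beta_add_one_left hm0 hl0]
  have hN : ∀ a b, 0 < a → 0 < b → ∫ x, (a * u b x) ^ lam =
      a ^ lam * ((b ^ n)⁻¹ * (m * V * (B * (l / (m + l))))) := by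
    intro a b ha hb
    have e : ∀ x, (a * u b x) ^ lam = a ^ lam * (max (1 - (b * gauge K x) ^ p) 0) ^ l :=
      fun x => by
        rw [mul_rpow ha.le (hu0 b x), hu, ← rpow_mul (le_max_right _ _), hsl']
    simp only [e]
    rw [integral_const_mul, integral_gauge_profile volume hK_conv hK_cpt hK_zero hp0 hb hl0,
      finrank_euclideanSpace_fin, ← hm, measureReal_def, ← hV, beta_add_one_right hm0 hl0]
  have hnm : (n : ℝ) = m * p := by rw [hm]; field_simp
  constructor
  · intro heq
    have hF0 : 0 < ∫ x, f x := by
      obtain ⟨x, hx⟩ := Function.ne_iff.1 hf_ne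
      exact hf_cont.integral_pos_of_hasCompactSupport_nonneg_nonzero hf_supp hf_nonneg hx
    have hpos := heq ▸ rpow_pos_of_pos hF0 ((n : ℝ) + p * l)
    have hM0 : 0 < ∫ x, f x * gauge K x ^ p := by
      refine lt_of_le_of_ne (integral_nonneg fun x =>
        mul_nonneg (hf_nonneg x) (rpow_nonneg (gauge_nonneg x) p)) fun h => ?_
      rw [← h, zero_rpow hn0.ne'] at hpos
      simp at hpos
    have hN0 : 0 < ∫ x, f x ^ lam := by
      refine lt_of_le_of_ne (integral_nonneg fun x => rpow_nonneg (hf_nonneg x) lam) fun h => ?_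
      rw [← h, zero_rpow (by positivity), zero_rpow (by positivity)] at hpos
      simp at hpos
    set F := ∫ x, f x
    set M := ∫ x, f x * gauge K x ^ p
    set N := ∫ x, f x ^ lam
    have hml : 0 < m + l := by linarith
    obtain ⟨b, hb, hbM⟩ : ∃ b : ℝ, 0 < b ∧ b ^ p = m / (m + l) * F / M :=
      ⟨(m / (m + l) * F / M) ^ p⁻¹, by positivity, rpow_inv_rpow (by positivity) hp0.ne'⟩
    obtain ⟨a, ha, haN⟩ : ∃ a : ℝ, 0 < a ∧
        a ^ lam = N / ((b ^ n)⁻¹ * (m * V * (B * (l / (m + l))))) :=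
      ⟨(N / ((b ^ n)⁻¹ * (m * V * (B * (l / (m + l)))))) ^ lam⁻¹, by positivity,
        rpow_inv_rpow (by positivity) hlam0.ne'⟩
    have hNa : a ^ lam * ((b ^ n)⁻¹ * (m * V * (B * (l / (m + l))))) = N := by
      rw [haN, div_mul_cancel₀ _ (by positivity)]
    obtain ⟨G, hG⟩ : ∃ G, G = a * ((b ^ n)⁻¹ * (m * V * B)) := ⟨_, rfl⟩
    have hG0 : 0 < G := hG ▸ by positivity
    have hMG : a * ((b ^ n)⁻¹ * (b ^ p)⁻¹ * (m * V * (B * (m / (m + l))))) = G / F * M := by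
      rw [hG, hbM]
      field_simp
    have hid' := profile_moment_identity hm0 hnm hlam hl ha hb hV0 hB0
    rw [hNa, hMG, ← hG, mul_rpow (by positivity) hM0.le] at hid'
    have hGF : G = F := by
      have h1 : G ^ ((n : ℝ) + p * l) = (G / F) ^ (n : ℝ) * F ^ ((n : ℝ) + p * l) := by
        rw [hid', heq]
        ring
      have h2 : (G / F) ^ (p * l) = 1 := by
        have h3 := div_rpow hG0.le hF0.le ((n : ℝ) + p * l)
        rw [h1, mul_div_cancel_right₀ _ (by positivity), rpow_add (by positivity)] at h3
        exact (mul_eq_left₀ (by positivity)).1 h3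
      rw [← one_rpow (p * l), rpow_left_inj (by positivity) zero_le_one (by positivity)] at h2
      exact (div_eq_one_iff_eq hF0.ne').1 h2
    suffices f = fun x => a * u b x from ⟨a, b, ha, hb, fun x => congrFun this x⟩
    have hg := continuous_gauge hK_conv (mem_interior_iff_mem_nhds.1 hK_zero)
    have hgp : Continuous fun x => gauge K x ^ p := hg.rpow_const fun _ => .inr hp0.le
    refine eq_of_integral_mul_eq_integral_rpow (μ := volume) (h := fun x => a * u b x)
      (w := fun x => a ^ (lam - 1) * (1 - b ^ p * gauge K x ^ p)) hlam hf_cont hf_supp hf_nonneg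
      (continuous_const.mul (continuous_gauge_profile hK_conv hK_zero hp0 hs0))
      ((hasCompactSupport_gauge_profile hK_conv hK_cpt hK_zero hp0 hb hs0).mul_left
        (f := fun _ => a))
      (fun x => mul_nonneg ha.le (hu0 b x))
      (continuous_const.mul (continuous_const.sub (continuous_const.mul hgp))) (fun x => ?_)
      ((hN a b ha hb).trans hNa).symm ?_
    · rw [mul_rpow ha.le (hu0 b x), hu, ← rpow_mul (le_max_right _ _), hslam, rpow_one,
        mul_rpow hb.le (gauge_nonneg x)]
      exact mul_le_mul_of_nonneg_left (le_max_left _ _) (by positivity)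
    · have e : ∀ x, f x * (a ^ (lam - 1) * (1 - b ^ p * gauge K x ^ p)) =
          a ^ (lam - 1) * (f x - b ^ p * (f x * gauge K x ^ p)) := fun x => by ring
      simp only [e]
      rw [integral_const_mul, integral_sub (hf_cont.integrable_of_hasCompactSupport hf_supp)
        (by exact ((hf_cont.mul hgp).integrable_of_hasCompactSupport
          hf_supp.mul_right).const_mul _),
        integral_const_mul, hN a b ha hb]
      change a ^ (lam - 1) * (F - b ^ p * M) = _
      have ea : a ^ lam = a ^ (lam - 1) * a := by rw [← rpow_add_one ha.ne', sub_add_cancel]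
      rw [hbM, div_mul_cancel₀ _ hM0.ne', ea, ← hGF, hG]
      field_simp
      ring
  · rintro ⟨a, b, ha, hb, hfab⟩
    have hfab' : ∀ x, f x = a * u b x := hfab
    simp only [hfab']
    rw [hF a b ha hb, hM a b ha hb, hN a b ha hb]
    exact profile_moment_identity hm0 hnm hlam hl ha hb hV0 hB0
end
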